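/- arXiv:1711.04265 — 7 statements merged into one kernel-verified Lean document; each statement's English description precedes it below -/
import Mathlib

section
/- Let x = (x_n) be a real sequence. Then the set {ω ∈ (0,1] : Γ_x = Γ_{x↾ω}} is not meager in (0,1] if and only if every ordinary limit point of x is also a statistical cluster point of x, i.e., Γ_x = L_x. -/
open Filter Set Topology
open scoped Classical

/-- Upper asymptotic density `d*(X) = limsup_{n→∞} |X ∩ [1,n]| / n`. -/
noncomputable def upperDensity (X : Set ℕ) : ℝ :=
  Filter.limsup
    (fun n : ℕ => (((Finset.Icc 1 n).filter (fun i => i ∈ X)).card : ℝ) / n)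
    Filter.atTop

/-- `ℓ` is an ordinary limit point of `x`: some subsequence converges to `ℓ`. -/
def IsLimitPt (x : ℕ → ℝ) (ℓ : ℝ) : Prop :=
  ∃ φ : ℕ → ℕ, StrictMono φ ∧
    Filter.Tendsto (fun k => x (φ k)) Filter.atTop (nhds ℓ)

/-- `L_x`, the set of ordinary limit points of `x`. -/
def limitPts (x : ℕ → ℝ) : Set ℝ := {ℓ | IsLimitPt x ℓ}

/-- `ℓ` is a statistical cluster point of `x`. -/
def IsStatClusterPt (x : ℕ → ℝ) (ℓ : ℝ) : Prop :=
  ∀ ε : ℝ, 0 < ε → 0 < upperDensity {n : ℕ | |x n - ℓ| ≤ ε}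

/-- `Γ_x`, the set of statistical cluster points of `x`. -/
def statClusterPts (x : ℕ → ℝ) : Set ℝ := {ℓ | IsStatClusterPt x ℓ}

/-- `ℓ` is a statistical limit point of `x`: some subsequence along an index set
of positive upper density converges to `ℓ`. -/
def IsStatLimitPt (x : ℕ → ℝ) (ℓ : ℝ) : Prop :=
  ∃ φ : ℕ → ℕ, StrictMono φ ∧
    Filter.Tendsto (fun k => x (φ k)) Filter.atTop (nhds ℓ) ∧
    0 < upperDensity (Set.range φ)

/-- `Λ_x`, the set of statistical limit points of `x`. -/
def statLimitPts (x : ℕ → ℝ) : Set ℝ := {ℓ | IsStatLimitPt x ℓ}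

/-- The `n`-th binary digit (`n ≥ 1`) of `ω ∈ (0,1]` in the unique binary
representation of `ω` having infinitely many digits equal to `1`:
the partial sums of that representation are `s_N = (⌈2^N ω⌉ - 1)/2^N`. -/
noncomputable def binDigit (ω : ℝ) (n : ℕ) : ℤ :=
  ⌈(2 : ℝ) ^ n * ω⌉ - 2 * ⌈(2 : ℝ) ^ (n - 1) * ω⌉ + 1

/-- The set of indices `n ≥ 1` with `d_n(ω) = 1`. -/
def digitOneSet (ω : ℝ) : Set ℕ := {n | 1 ≤ n ∧ binDigit ω n = 1}

/-- The subsequence `x↾ω` of `x` obtained by choosing, in increasing order,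
all indices `n` with `d_n(ω) = 1`. -/
noncomputable def subseq (x : ℕ → ℝ) (ω : ℝ) : ℕ → ℝ :=
  fun k => x (Nat.nth (fun n => n ∈ digitOneSet ω) k)

/-- `q_{ω,m}(N)`: the proportion, among the first `N` terms of `x↾ω`,
of those within `1/m` of `ℓ`. -/
noncomputable def qdens (x : ℕ → ℝ) (ℓ : ℝ) (ω : ℝ) (m N : ℕ) : ℝ :=
  (((Finset.range N).filter (fun i => |subseq x ω i - ℓ| ≤ 1 / m)).card : ℝ) / N

/-- The limsup defining a positive upper density, unfolded. -/
theorem upperDensity_pos_iff (X : Set ℕ) :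
    0 < upperDensity X ↔ ∃ c : ℝ, 0 < c ∧ ∃ᶠ n : ℕ in atTop,
      c ≤ (((Finset.Icc 1 n).filter (fun i => i ∈ X)).card : ℝ) / n := by
  have nonneg (n : ℕ) :
      (0 : ℝ) ≤ (((Finset.Icc 1 n).filter (fun i => i ∈ X)).card : ℝ) / n := by positivity
  have le_one (n : ℕ) :
      (((Finset.Icc 1 n).filter (fun i => i ∈ X)).card : ℝ) / n ≤ 1 := by
    refine div_le_one_of_le₀ ?_ (Nat.cast_nonneg n)
    have := Finset.card_filter_le (Finset.Icc 1 n) (fun i => i ∈ X)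
    rw [Nat.card_Icc, Nat.add_sub_cancel] at this
    exact_mod_cast this
  constructor
  · intro h
    refine ⟨upperDensity X / 2, half_pos h, ?_⟩
    refine (frequently_lt_of_lt_limsup ?_ (half_lt_self h)).mono fun n hn => hn.le
    exact (isBoundedUnder_of ⟨0, nonneg⟩ : IsBoundedUnder (· ≥ ·) _ _).isCoboundedUnder_le
  · rintro ⟨c, hc, hf⟩
    exact hc.trans_le (le_limsup_of_frequently_le hf (isBoundedUnder_of ⟨1, le_one⟩))

theorem upperDensity_pos_mono {X Y : Set ℕ} (hXY : X ⊆ Y) (hX : 0 < upperDensity X) :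
    0 < upperDensity Y := by
  rw [upperDensity_pos_iff] at hX ⊢
  obtain ⟨c, hc, hf⟩ := hX
  refine ⟨c, hc, hf.mono fun n hn => hn.trans ?_⟩
  gcongr

theorem infinite_of_upperDensity_pos {X : Set ℕ} (hX : 0 < upperDensity X) : X.Infinite := by
  intro hfin
  obtain ⟨c, hc, hf⟩ := (upperDensity_pos_iff X).1 hX
  obtain ⟨n, hn, hlt⟩ :=
    (hf.and_eventually (tendsto_natCast_atTop_atTop.eventually_gt_atTop
      ((hfin.toFinset.card : ℝ) / c))).exists
  have hK : (0 : ℝ) ≤ (hfin.toFinset.card : ℝ) / c := by positivity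
  rw [le_div_iff₀ (hK.trans_lt hlt)] at hn
  rw [div_lt_iff₀ hc] at hlt
  have hcard : ((Finset.Icc 1 n).filter (fun i => i ∈ X)).card ≤ hfin.toFinset.card :=
    Finset.card_le_card fun i hi => by simpa using (Finset.mem_filter.1 hi).2
  have : (((Finset.Icc 1 n).filter (fun i => i ∈ X)).card : ℝ) ≤ hfin.toFinset.card := by
    exact_mod_cast hcard
  linarith [mul_comm c (n : ℝ)]

theorem IsStatClusterPt.isLimitPt {x : ℕ → ℝ} {ℓ : ℝ} (h : IsStatClusterPt x ℓ) :
    IsLimitPt x ℓ := by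
  apply MapClusterPt.tendsto_subseq
  rw [mapClusterPt_iff_frequently]
  intro s hs
  obtain ⟨ε, hε, hball⟩ := Metric.nhds_basis_closedBall.mem_iff.1 hs
  refine (Nat.frequently_atTop_iff_infinite.2
    (infinite_of_upperDensity_pos (h ε hε))).mono fun n hn => hball ?_
  simpa [Real.dist_eq] using hn

theorem IsLimitPt.infinite {x : ℕ → ℝ} {ℓ : ℝ} (h : IsLimitPt x ℓ) {ε : ℝ} (hε : 0 < ε) :
    {n : ℕ | |x n - ℓ| ≤ ε}.Infinite := by
  obtain ⟨φ, hφ, hlim⟩ := h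
  rw [← Nat.frequently_atTop_iff_infinite]
  refine hφ.tendsto_atTop.frequently (Eventually.frequently ?_)
  filter_upwards [hlim (Metric.closedBall_mem_nhds ℓ hε)] with k hk
  simpa [Real.dist_eq] using hk

theorem IsLimitPt.of_comp {x : ℕ → ℝ} {φ : ℕ → ℕ} (hφ : StrictMono φ) {ℓ : ℝ}
    (h : IsLimitPt (fun k => x (φ k)) ℓ) : IsLimitPt x ℓ := by
  obtain ⟨ψ, hψ, hlim⟩ := h
  exact ⟨φ ∘ ψ, hφ.comp hψ, hlim⟩

theorem isClosed_statClusterPts (x : ℕ → ℝ) : IsClosed (statClusterPts x) := by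
  refine isClosed_of_closure_subset fun ℓ hℓ ε hε => ?_
  obtain ⟨ℓ', hℓ', hd⟩ := Metric.mem_closure_iff.1 hℓ (ε / 2) (half_pos hε)
  refine upperDensity_pos_mono (fun n hn => ?_) (hℓ' (ε / 2) (half_pos hε))
  rw [Real.dist_eq, abs_sub_comm] at hd
  have := abs_sub_le (x n) ℓ' ℓ
  simp only [Set.mem_ofPred_eq] at hn ⊢
  linarith

theorem binDigit_succ_eq_zero_or_one (ω : ℝ) (n : ℕ) :
    binDigit ω (n + 1) = 0 ∨ binDigit ω (n + 1) = 1 := by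
  have h1 := Int.le_ceil ((2 : ℝ) ^ n * ω)
  have h2 := Int.ceil_lt_add_one ((2 : ℝ) ^ n * ω)
  have h3 := Int.le_ceil ((2 : ℝ) ^ (n + 1) * ω)
  have h4 := Int.ceil_lt_add_one ((2 : ℝ) ^ (n + 1) * ω)
  unfold binDigit
  rw [Nat.add_sub_cancel]
  rw [pow_succ] at *
  generalize ⌈(2 : ℝ) ^ n * ω⌉ = a at *
  generalize ⌈(2 : ℝ) ^ n * 2 * ω⌉ = b at *
  have h5 : (b : ℝ) < ((2 * a + 1 : ℤ) : ℝ) := by push_cast; linarith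
  have h6 : ((2 * a - 2 : ℤ) : ℝ) < (b : ℝ) := by push_cast; linarith
  rw [Int.cast_lt] at h5 h6
  omega

theorem infinite_digitOneSet (ω : ℝ) : (digitOneSet ω).Infinite := by
  intro hfin
  obtain ⟨n, hn⟩ := hfin.bddAbove
  have hzero (i : ℕ) : binDigit ω (n + i + 1) = 0 := by
    refine (binDigit_succ_eq_zero_or_one ω (n + i)).resolve_right fun h => ?_
    have := hn (show n + i + 1 ∈ digitOneSet ω from ⟨by omega, h⟩)
    omega
  have hceil (i : ℕ) : ⌈(2 : ℝ) ^ (n + i) * ω⌉ - 1 = 2 ^ i * (⌈(2 : ℝ) ^ n * ω⌉ - 1) := by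
    induction i with
    | zero => simp
    | succ i ih =>
      have h := hzero i
      unfold binDigit at h
      rw [Nat.add_sub_cancel] at h
      rw [← add_assoc, pow_succ (2 : ℤ) i]
      linear_combination h + 2 * ih
  have hpos : 0 < (2 : ℝ) ^ n * ω - (⌈(2 : ℝ) ^ n * ω⌉ - 1) := by
    linarith [Int.ceil_lt_add_one ((2 : ℝ) ^ n * ω)]
  obtain ⟨i, hi⟩ := pow_unbounded_of_one_lt
    (1 / ((2 : ℝ) ^ n * ω - (⌈(2 : ℝ) ^ n * ω⌉ - 1))) (one_lt_two : (1 : ℝ) < 2)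
  rw [div_lt_iff₀ hpos] at hi
  have h1 := Int.le_ceil ((2 : ℝ) ^ (n + i) * ω)
  have h2 : ((⌈(2 : ℝ) ^ (n + i) * ω⌉ : ℝ) - 1) = 2 ^ i * (⌈(2 : ℝ) ^ n * ω⌉ - 1) := by
    exact_mod_cast hceil i
  rw [pow_add] at h1 h2
  nlinarith

theorem strictMono_nth_digitOneSet (ω : ℝ) :
    StrictMono (Nat.nth (fun n => n ∈ digitOneSet ω)) :=
  Nat.nth_strictMono (infinite_digitOneSet ω)

theorem statClusterPts_subseq_subset (x : ℕ → ℝ) (ω : ℝ) :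
    statClusterPts (subseq x ω) ⊆ limitPts x := fun _ h =>
  IsLimitPt.of_comp (strictMono_nth_digitOneSet ω) (IsStatClusterPt.isLimitPt h)

/-- Inside any open dyadic interval of level `n`, the digits with indices in `(n, k]` can be
prescribed on an open dyadic interval of level `k`. -/
theorem exists_dyadic_prescribed_digits (T : Set ℕ) (n : ℕ) (a : ℤ) {k : ℕ} (hk : n ≤ k) :
    ∃ b : ℤ, ∀ ω : ℝ, (b - 1 : ℝ) < 2 ^ k * ω → 2 ^ k * ω < b →
      ((a - 1 : ℝ) < 2 ^ n * ω ∧ 2 ^ n * ω < a) ∧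
        ∀ j, n < j → j ≤ k → (binDigit ω j = 1 ↔ j ∈ T) := by
  induction k, hk using Nat.le_induction with
  | base => exact ⟨a, fun ω h1 h2 => ⟨⟨h1, h2⟩, fun j hj hj' => by omega⟩⟩
  | succ k hk ih =>
    obtain ⟨b, hb⟩ := ih
    have key (e : ℤ) (he : e = 0 ∨ e = 1) (ω : ℝ)
        (h1 : ((2 * b - 1 + e : ℤ) - 1 : ℝ) < 2 ^ (k + 1) * ω)
        (h2 : 2 ^ (k + 1) * ω < ((2 * b - 1 + e : ℤ) : ℝ)) :
        ((b - 1 : ℝ) < 2 ^ k * ω ∧ 2 ^ k * ω < b) ∧ binDigit ω (k + 1) = e := by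
      have hceil' : ⌈(2 : ℝ) ^ (k + 1) * ω⌉ = 2 * b - 1 + e := Int.ceil_eq_iff.2 ⟨h1, h2.le⟩
      have hω : (b - 1 : ℝ) < 2 ^ k * ω ∧ 2 ^ k * ω < b := by
        rw [pow_succ] at h1 h2
        push_cast at h1 h2
        rcases he with rfl | rfl <;> push_cast at h1 h2 <;> constructor <;> linarith
      have hceil : ⌈(2 : ℝ) ^ k * ω⌉ = b := Int.ceil_eq_iff.2 ⟨hω.1, hω.2.le⟩
      refine ⟨hω, ?_⟩
      unfold binDigit
      rw [Nat.add_sub_cancel, hceil, hceil']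
      ring
    refine ⟨2 * b - 1 + (if k + 1 ∈ T then 1 else 0), fun ω h1 h2 => ?_⟩
    obtain ⟨hω, hd⟩ := key _ (by split_ifs <;> simp) ω h1 h2
    obtain ⟨hn, hj⟩ := hb ω hω.1 hω.2
    refine ⟨hn, fun j hnj hjk => ?_⟩
    rcases Nat.lt_or_ge k j with h | h
    · obtain rfl : j = k + 1 := by omega
      rw [hd]
      split_ifs with hT <;> simp [hT]
    · exact hj j hnj h

/-- If an infinite set `S` agrees with `T` on `(n, k]`, and `T` has many elements there, then most
of the elements of `S` up to `k` belong to `T`. -/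
theorem exists_le_two_mul_card_nth_mem {S T : Set ℕ} (hS : S.Infinite) {n k m : ℕ}
    (hST : ∀ j, n < j → j ≤ k → (j ∈ S ↔ j ∈ T))
    (hcard : 2 * n + m + 4 ≤ ((Finset.Ioc n k).filter (fun j => j ∈ T)).card) :
    ∃ N, m < N ∧
      N ≤ 2 * ((Finset.Icc 1 N).filter (fun i => Nat.nth (fun j => j ∈ S) i ∈ T)).card := by
  have hcount : ((Finset.Ioc n k).filter (fun j => j ∈ T)).card ≤
      Nat.count (fun j => j ∈ S) (k + 1) := by
    rw [Nat.count_eq_card_filter_range]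
    refine Finset.card_le_card fun j hj => ?_
    simp only [Finset.mem_filter, Finset.mem_Ioc, Finset.mem_range] at hj ⊢
    exact ⟨by omega, (hST j hj.1.1 hj.1.2).2 hj.2⟩
  have hn := Nat.count_le (p := fun j => j ∈ S) (n := n + 1)
  set C := Nat.count (fun j => j ∈ S) (k + 1)
  refine ⟨C - 1, by omega, ?_⟩
  have hsub : Finset.Icc (n + 1) (C - 1) ⊆
      (Finset.Icc 1 (C - 1)).filter (fun i => Nat.nth (fun j => j ∈ S) i ∈ T) := by
    intro i hi
    rw [Finset.mem_Icc] at hi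
    rw [Finset.mem_filter, Finset.mem_Icc]
    refine ⟨by omega, (hST _ ?_ ?_).1 (Nat.nth_mem_of_infinite hS i)⟩
    · exact lt_of_lt_of_le (Nat.lt_succ_self n)
        (((Nat.count_le_iff_le_nth (p := fun j => j ∈ S) hS).1 (hn.trans hi.1)))
    · exact Nat.lt_succ_iff.1 (Nat.nth_lt_of_lt_count (show i < C by omega))
  have := Finset.card_le_card hsub
  rw [Nat.card_Icc] at this
  omega

/-- Every nonempty relatively open subset of `(0, 1]` contains an open dyadic interval. -/
theorem exists_dyadic_subset {W : Set (Set.Ioc (0 : ℝ) 1)} (hW : IsOpen W) (hne : W.Nonempty) :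
    ∃ (n : ℕ) (a : ℤ), ∀ ω : ℝ, (a - 1 : ℝ) < 2 ^ n * ω → 2 ^ n * ω < a →
      ∃ h : ω ∈ Set.Ioc (0 : ℝ) 1, (⟨ω, h⟩ : Set.Ioc (0 : ℝ) 1) ∈ W := by
  obtain ⟨⟨p, hp⟩, hpW⟩ := hne
  obtain ⟨ε, hε, hball⟩ := Metric.isOpen_iff.1 hW _ hpW
  obtain ⟨n, hn⟩ := pow_unbounded_of_one_lt (1 / ε) (one_lt_two : (1 : ℝ) < 2)
  rw [div_lt_iff₀ hε] at hn
  have h2 : (0 : ℝ) < 2 ^ n := by positivity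
  refine ⟨n, ⌈(2 : ℝ) ^ n * p⌉, fun ω h1 h3 => ?_⟩
  have hc1 := Int.le_ceil ((2 : ℝ) ^ n * p)
  have hc2 := Int.ceil_lt_add_one ((2 : ℝ) ^ n * p)
  have hpos : (1 : ℝ) ≤ ⌈(2 : ℝ) ^ n * p⌉ := by
    exact_mod_cast Int.one_le_ceil_iff.2 (mul_pos h2 hp.1)
  have hle : (⌈(2 : ℝ) ^ n * p⌉ : ℝ) ≤ 2 ^ n := by
    have : ⌈(2 : ℝ) ^ n * p⌉ ≤ 2 ^ n := by
      rw [Int.ceil_le]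
      push_cast
      nlinarith [hp.2]
    exact_mod_cast this
  refine ⟨⟨?_, ?_⟩, hball ?_⟩
  · by_contra! h
    nlinarith
  · by_contra! h
    nlinarith
  · rw [Metric.mem_ball, Subtype.dist_eq, Real.dist_eq, abs_lt]
    constructor <;> by_contra! h <;> nlinarith

/-- For an infinite set `T` of indices, the generic `ω` selects arbitrarily long initial pieces of
which at least half lies in `T`. -/
theorem residual_exists_le_two_mul_card {T : Set ℕ} (hT : T.Infinite) (m : ℕ) :
    {ω : Set.Ioc (0 : ℝ) 1 | ∃ N, m < N ∧ N ≤ 2 * ((Finset.Icc 1 N).filter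
      (fun i => Nat.nth (fun j => j ∈ digitOneSet ω.1) i ∈ T)).card} ∈ residual _ := by
  refine mem_of_superset (residual_of_dense_open isOpen_interior ?_) interior_subset
  rw [dense_iff_inter_open]
  intro W hW hne
  obtain ⟨n, a, ha⟩ := exists_dyadic_subset hW hne
  obtain ⟨s, hsT, hs⟩ := (hT.sdiff (Set.finite_Iic n)).exists_subset_card_eq (2 * n + m + 4)
  obtain ⟨k, hk⟩ := s.bddAbove
  obtain ⟨b, hb⟩ := exists_dyadic_prescribed_digits T n a (le_max_left n k)
  set K := max n k
  have h2 : (0 : ℝ) < 2 ^ K := by positivity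
  have hmid : (2 : ℝ) ^ K * ((b - 1 / 2) / 2 ^ K) = b - 1 / 2 := by field_simp
  have hmid1 : (b - 1 : ℝ) < 2 ^ K * ((b - 1 / 2) / 2 ^ K) := by rw [hmid]; linarith
  have hmid2 : (2 : ℝ) ^ K * ((b - 1 / 2) / 2 ^ K) < b := by rw [hmid]; linarith
  obtain ⟨hmem, hmemW⟩ := ha _ (hb _ hmid1 hmid2).1.1 (hb _ hmid1 hmid2).1.2
  refine ⟨⟨_, hmem⟩, hmemW, mem_interior.2
    ⟨{ω | (b - 1 : ℝ) < 2 ^ K * ω.1 ∧ 2 ^ K * ω.1 < b}, ?_, ?_, hmid1, hmid2⟩⟩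
  · rintro ω ⟨h1, h3⟩
    refine exists_le_two_mul_card_nth_mem (n := n) (k := K) (infinite_digitOneSet ω.1)
      (fun j hnj hjK => ?_) ?_
    · rw [← (hb ω.1 h1 h3).2 j hnj hjK]
      exact ⟨fun h => h.2, fun h => ⟨by omega, h⟩⟩
    · rw [← hs]
      refine Finset.card_le_card fun j hj => ?_
      have hjT := hsT hj
      simp only [Set.mem_sdiff, Set.mem_Iic, not_le] at hjT
      rw [Finset.mem_filter, Finset.mem_Ioc]
      exact ⟨⟨hjT.2, (hk hj).trans (le_max_right n k)⟩, hjT.1⟩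
  · have hcont : Continuous fun ω : Set.Ioc (0 : ℝ) 1 => (2 : ℝ) ^ K * ω.1 := by fun_prop
    exact (isOpen_lt continuous_const hcont).inter (isOpen_lt hcont continuous_const)

theorem IsLimitPt.residual_isStatClusterPt_subseq {x : ℕ → ℝ} {ℓ : ℝ} (h : IsLimitPt x ℓ) :
    ∀ᶠ ω : Set.Ioc (0 : ℝ) 1 in residual _, IsStatClusterPt (subseq x ω.1) ℓ := by
  have hgen : ∀ᶠ ω : Set.Ioc (0 : ℝ) 1 in residual _, ∀ r m : ℕ, ∃ N, m < N ∧
      N ≤ 2 * ((Finset.Icc 1 N).filter (fun i => Nat.nth (fun j => j ∈ digitOneSet ω.1) i ∈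
        {n : ℕ | |x n - ℓ| ≤ 1 / ((r : ℝ) + 1)})).card :=
    eventually_countable_forall.2 fun r => eventually_countable_forall.2 fun m =>
      residual_exists_le_two_mul_card (h.infinite Nat.one_div_pos_of_nat) m
  filter_upwards [hgen] with ω hω ε hε
  obtain ⟨r, hr⟩ := exists_nat_one_div_lt hε
  refine upperDensity_pos_mono (X := {n : ℕ | |subseq x ω.1 n - ℓ| ≤ 1 / ((r : ℝ) + 1)})
    (fun n hn => le_trans hn hr.le) ?_
  rw [upperDensity_pos_iff]
  refine ⟨1 / 2, by norm_num, frequently_atTop.2 fun m => ?_⟩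
  obtain ⟨N, hmN, hN⟩ := hω r m
  refine ⟨N, hmN.le, ?_⟩
  have hNpos : (0 : ℝ) < N := by exact_mod_cast (Nat.zero_le m).trans_lt hmN
  rw [le_div_iff₀ hNpos]
  have hN' : (N : ℝ) ≤ 2 * (((Finset.Icc 1 N).filter
      (fun i => i ∈ {n : ℕ | |subseq x ω.1 n - ℓ| ≤ 1 / ((r : ℝ) + 1)})).card : ℝ) := by
    exact_mod_cast hN
  linarith

/-- The generic subsequence has all ordinary limit points of `x` as statistical cluster points. -/
theorem residual_statClusterPts_subseq_eq (x : ℕ → ℝ) :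
    ∀ᶠ ω : Set.Ioc (0 : ℝ) 1 in residual _, statClusterPts (subseq x ω.1) = limitPts x := by
  obtain ⟨D, hDL, hDc, hLD⟩ :=
    (TopologicalSpace.IsSeparable.of_separableSpace (limitPts x)).exists_countable_dense_subset
  have hD : ∀ᶠ ω : Set.Ioc (0 : ℝ) 1 in residual _, ∀ ℓ ∈ D, IsStatClusterPt (subseq x ω.1) ℓ :=
    (eventually_countable_ball hDc).2 fun ℓ hℓ => (hDL hℓ).residual_isStatClusterPt_subseq
  filter_upwards [hD] with ω hω
  exact (statClusterPts_subseq_subset x ω.1).antisymm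
    (hLD.trans (closure_minimal hω (isClosed_statClusterPts _)))

/-- Theorem 2 (main): `{ω ∈ (0,1] : Γ_x = Γ_{x↾ω}}` is non-meager in `(0,1]`
iff every ordinary limit point of `x` is a statistical cluster point, i.e. `Γ_x = L_x`. -/
theorem stmt0 (x : ℕ → ℝ) :
    ¬ IsMeagre {ω : Set.Ioc (0 : ℝ) 1 | statClusterPts x = statClusterPts (subseq x ω.1)} ↔
      statClusterPts x = limitPts x := by
  have hres := residual_statClusterPts_subseq_eq x
  have : LocallyCompactSpace (Set.Ioc (0 : ℝ) 1) := isLocallyClosed_Ioc.locallyCompactSpace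
  have : Nonempty (Set.Ioc (0 : ℝ) 1) := ⟨⟨1, by norm_num⟩⟩
  constructor
  · intro h
    by_contra hne
    refine h (mem_of_superset hres fun ω hω hΓ => hne (hΓ.trans hω))
  · intro h hmeagre
    obtain ⟨ω, hω, hΓ⟩ := (dense_of_mem_residual (inter_mem hres hmeagre)).nonempty
    exact hΓ (h.trans hω.symm)
end

section
/- Let x = (x_n) be a real sequence admitting an ordinary limit point that is not a statistical cluster point of x, i.e., Γ_x ⊊ L_x. Then the set {ω ∈ (0,1] : Γ_x = Γ_{x↾ω}} is meager in (0,1]. -/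
open Filter Set Topology
open scoped Classical

theorem ceil_two_pow_mul_eq {ω : ℝ} {n : ℕ} {c c' : ℤ} (h : ⌈(2 : ℝ) ^ (n + 1) * ω⌉ = c')
    (hl : 2 * c - 1 ≤ c') (hu : c' ≤ 2 * c) : ⌈(2 : ℝ) ^ n * ω⌉ = c := by
  rw [Int.ceil_eq_iff] at h ⊢
  have hl' : 2 * (c : ℝ) - 1 ≤ c' := by exact_mod_cast hl
  have hu' : (c' : ℝ) ≤ 2 * c := by exact_mod_cast hu
  rw [pow_succ] at h
  constructor <;> linarith [h.1, h.2]

/-- Any finite string of binary digits can be prolonged so that the new ones are dictated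
by a given set `A`. -/
theorem exists_ceil_prescribing_digits (A : Set ℕ) {M : ℕ} {c₀ : ℤ} (h1 : 1 ≤ c₀)
    (h2 : c₀ ≤ 2 ^ M) {n : ℕ} (hn : M ≤ n) :
    ∃ c : ℤ, 1 ≤ c ∧ c ≤ 2 ^ n ∧ ∀ ω : ℝ, ⌈(2 : ℝ) ^ n * ω⌉ = c →
      ⌈(2 : ℝ) ^ M * ω⌉ = c₀ ∧ ∀ j, M < j → j ≤ n → (binDigit ω j = 1 ↔ j ∈ A) := by
  induction n, hn using Nat.le_induction with
  | base => exact ⟨c₀, h1, h2, fun ω h => ⟨h, fun j hj hj' => by omega⟩⟩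
  | succ n hn ih =>
    obtain ⟨c, hc1, hc2, hc⟩ := ih
    refine ⟨2 * c - if n + 1 ∈ A then 0 else 1, by split_ifs <;> omega, ?_, fun ω h => ?_⟩
    · rw [pow_succ]; split_ifs <;> omega
    have hcω : ⌈(2 : ℝ) ^ n * ω⌉ = c :=
      ceil_two_pow_mul_eq h (by split_ifs <;> omega) (by split_ifs <;> omega)
    refine ⟨(hc ω hcω).1, fun j hj hj' => ?_⟩
    rcases hj'.lt_or_eq with hlt | rfl
    · exact (hc ω hcω).2 j hj (by omega)
    · rw [binDigit, h, Nat.add_sub_cancel, hcω]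
      split_ifs with hA <;> simp [hA]

theorem IsLimitPt.infinite_near {x : ℕ → ℝ} {ℓ ε : ℝ} (h : IsLimitPt x ℓ) (hε : 0 < ε) :
    {n | |x n - ℓ| ≤ ε}.Infinite := by
  obtain ⟨φ, hφ, hlim⟩ := h
  have hev : ∀ᶠ k in atTop, |x (φ k) - ℓ| ≤ ε := by
    filter_upwards [hlim.eventually (Metric.closedBall_mem_nhds ℓ hε)] with k hk
    simpa [Real.dist_eq] using hk
  rw [← Nat.frequently_atTop_iff_infinite]
  exact hφ.tendsto_atTop.frequently hev.frequently

theorem le_upperDensity_of_frequently {X : Set ℕ} {c : ℝ}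
    (h : ∃ᶠ n : ℕ in atTop, c ≤ (((Finset.Icc 1 n).filter (fun i => i ∈ X)).card : ℝ) / n) :
    c ≤ upperDensity X := by
  refine Filter.le_limsup_of_frequently_le h (isBoundedUnder_of ⟨1, fun n => ?_⟩)
  refine div_le_one_of_le₀ ?_ n.cast_nonneg
  exact_mod_cast (Finset.card_filter_le _ _).trans (by simp)

/-- If `S` agrees with `A` on `(M, n]`, then all terms but the first few of the increasing
enumeration of `S ∩ [0, n]` lie in `A`. -/
theorem nth_mem_of_agree {S A : Set ℕ} {M n i : ℕ}
    (hSA : ∀ j, M < j → j ≤ n → (j ∈ S ↔ j ∈ A))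
    (hMi : M < i) (hi : i < Nat.count (fun k => k ∈ S) (n + 1)) :
    Nat.nth (fun k => k ∈ S) i ∈ A := by
  have hlt := Nat.nth_lt_of_lt_count hi
  have hcard : ∀ hf : (Set.ofPred fun k => k ∈ S).Finite, i < hf.toFinset.card := fun hf =>
    hi.trans_le (Nat.count_le_card hf _)
  have hle : i ≤ Nat.nth (fun k => k ∈ S) i := by
    conv_lhs => rw [← Nat.count_nth hcard]
    exact Nat.count_le _
  exact (hSA _ (hMi.trans_le hle) (by omega)).1 (Nat.nth_mem i hcard)

/-- The set of `ω` for which at least half of some long initial segment of `x↾ω` is close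
to `ℓ`. -/
def halfNear (x : ℕ → ℝ) (ℓ ε : ℝ) (N₀ : ℕ) : Set (Set.Ioc (0 : ℝ) 1) :=
  {ω | ∃ N ≥ N₀, (1 / 2 : ℝ) ≤
    (((Finset.Icc 1 N).filter (fun i => i ∈ {n | |subseq x ω.1 n - ℓ| ≤ ε})).card : ℝ) / N}

theorem mem_halfNear_of_agree {x : ℕ → ℝ} {ℓ ε : ℝ} {N₀ M n : ℕ} {ω : Set.Ioc (0 : ℝ) 1}
    {T : Finset ℕ} (hT : ∀ t ∈ T, |x t - ℓ| ≤ ε ∧ M < t ∧ t ≤ n)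
    (hcard : T.card = 2 * M + N₀ + 2)
    (hdig : ∀ j, M < j → j ≤ n → (binDigit ω.1 j = 1 ↔ j ∈ {k | |x k - ℓ| ≤ ε})) :
    ω ∈ halfNear x ℓ ε N₀ := by
  have hSA : ∀ j, M < j → j ≤ n → (j ∈ digitOneSet ω.1 ↔ j ∈ {k | |x k - ℓ| ≤ ε}) :=
    fun j hj hj' => ⟨fun h => (hdig j hj hj').1 h.2, fun h => ⟨by omega, (hdig j hj hj').2 h⟩⟩
  have hcount : T.card ≤ Nat.count (fun k => k ∈ digitOneSet ω.1) (n + 1) := by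
    rw [Nat.count_eq_card_filter_range]
    refine Finset.card_le_card fun t ht => ?_
    obtain ⟨h1, h2, h3⟩ := hT t ht
    rw [Finset.mem_filter, Finset.mem_range]
    exact ⟨by omega, (hSA t h2 h3).2 h1⟩
  set N := Nat.count (fun k => k ∈ digitOneSet ω.1) (n + 1) - 1 with hN
  refine ⟨N, by omega, ?_⟩
  have hsub : Finset.Icc (M + 1) N ⊆
      (Finset.Icc 1 N).filter (fun i => i ∈ {n | |subseq x ω.1 n - ℓ| ≤ ε}) := by
    intro i hi
    rw [Finset.mem_Icc] at hi
    rw [Finset.mem_filter, Finset.mem_Icc]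
    exact ⟨by omega, nth_mem_of_agree hSA (by omega) (by omega)⟩
  have hc := Finset.card_le_card hsub
  rw [Nat.card_Icc] at hc
  have hNpos : (0 : ℝ) < N := by exact_mod_cast (show 0 < N by omega)
  rw [le_div_iff₀ hNpos]
  have : N ≤ 2 * ((Finset.Icc 1 N).filter
      (fun i => i ∈ {n | |subseq x ω.1 n - ℓ| ≤ ε})).card := by omega
  have : (N : ℝ) ≤ 2 * (((Finset.Icc 1 N).filter
      (fun i => i ∈ {n | |subseq x ω.1 n - ℓ| ≤ ε})).card : ℝ) := by exact_mod_cast this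
  linarith

theorem dense_interior_halfNear {x : ℕ → ℝ} {ℓ ε : ℝ} (h : IsLimitPt x ℓ) (hε : 0 < ε)
    (N₀ : ℕ) : Dense (interior (halfNear x ℓ ε N₀)) := by
  rw [Metric.dense_iff]
  intro ω r hr
  obtain ⟨M, hM⟩ := exists_pow_lt_of_lt_one hr (by norm_num : (1 / 2 : ℝ) < 1)
  obtain ⟨T, hTsub, hTcard⟩ :=
    ((h.infinite_near hε).sdiff (Set.finite_Iic M)).exists_subset_card_eq (2 * M + N₀ + 2)
  set n := max M (T.sup id)
  have hT : ∀ t ∈ T, |x t - ℓ| ≤ ε ∧ M < t ∧ t ≤ n := fun t ht =>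
    ⟨(hTsub ht).1, not_le.1 (hTsub ht).2,
      (Finset.le_sup (f := id) ht).trans (le_max_right _ _)⟩
  have hpow : ∀ k : ℕ, (0 : ℝ) < 2 ^ k := fun k => by positivity
  have h1 : 1 ≤ ⌈(2 : ℝ) ^ M * ω.1⌉ :=
    Int.one_le_ceil_iff.2 (mul_pos (hpow M) ω.2.1)
  have h2 : ⌈(2 : ℝ) ^ M * ω.1⌉ ≤ 2 ^ M := by
    rw [Int.ceil_le]; push_cast
    exact mul_le_of_le_one_right (hpow M).le ω.2.2
  obtain ⟨c, hc1, hc2, hc⟩ := exists_ceil_prescribing_digits {k | |x k - ℓ| ≤ ε} h1 h2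
    (le_max_left M (T.sup id))
  let V : Set (Set.Ioc (0 : ℝ) 1) := {ω' | (2 : ℝ) ^ n * ω'.1 ∈ Set.Ioo ((c : ℝ) - 1) c}
  have hVopen : IsOpen V :=
    isOpen_Ioo.preimage (continuous_const.mul continuous_subtype_val)
  have hVceil : ∀ ω' ∈ V, ⌈(2 : ℝ) ^ n * ω'.1⌉ = c := fun ω' hω' =>
    Int.ceil_eq_iff.2 ⟨hω'.1, hω'.2.le⟩
  have hVsub : V ⊆ halfNear x ℓ ε N₀ := fun ω' hω' =>
    mem_halfNear_of_agree hT hTcard (hc ω'.1 (hVceil ω' hω')).2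
  have hc1' : (1 : ℝ) ≤ c := by exact_mod_cast hc1
  have hc2' : (c : ℝ) ≤ 2 ^ n := by exact_mod_cast hc2
  let ω' : Set.Ioc (0 : ℝ) 1 := ⟨((c : ℝ) - 1 / 2) / 2 ^ n,
    div_pos (by linarith) (hpow n), div_le_one_of_le₀ (by linarith) (hpow n).le⟩
  have hω'V : ω' ∈ V := by
    have : (2 : ℝ) ^ n * ω'.1 = c - 1 / 2 := mul_div_cancel₀ _ (hpow n).ne'
    simp only [V, Set.mem_ofPred_eq, this, Set.mem_Ioo]
    constructor <;> linarith
  refine ⟨ω', ?_, interior_maximal hVsub hVopen hω'V⟩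
  obtain ⟨ha, hb⟩ := Int.ceil_eq_iff.1 (hc ω'.1 (hVceil ω' hω'V)).1
  have hd := Int.le_ceil ((2 : ℝ) ^ M * ω.1)
  have he := Int.ceil_lt_add_one ((2 : ℝ) ^ M * ω.1)
  rw [Metric.mem_ball, Subtype.dist_eq, Real.dist_eq]
  refine lt_trans ?_ hM
  rw [one_div, inv_pow, ← one_div, abs_lt, ← neg_div, div_lt_iff₀ (hpow M), lt_div_iff₀ (hpow M)]
  constructor <;> linarith

theorem IsLimitPt.eventually_residual_mem_statClusterPts {x : ℕ → ℝ} {ℓ : ℝ}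
    (h : IsLimitPt x ℓ) :
    ∀ᶠ ω : Set.Ioc (0 : ℝ) 1 in residual _, ℓ ∈ statClusterPts (subseq x ω.1) := by
  have hmem : ∀ k N₀ : ℕ, ∀ᶠ ω : Set.Ioc (0 : ℝ) 1 in residual _,
      ω ∈ halfNear x ℓ (1 / ((k : ℝ) + 1)) N₀ := fun k N₀ =>
    mem_of_superset (residual_of_dense_open isOpen_interior
      (dense_interior_halfNear h Nat.one_div_pos_of_nat N₀)) interior_subset
  filter_upwards [eventually_countable_forall.2 fun k =>
    eventually_countable_forall.2 (hmem k)] with ω hω ε hε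
  obtain ⟨k, hk⟩ := exists_nat_one_div_lt hε
  refine (by norm_num : (0 : ℝ) < 1 / 2).trans_le
    (le_upperDensity_of_frequently (frequently_atTop.2 fun N₀ => ?_))
  obtain ⟨N, hN, hle⟩ := hω k N₀
  refine ⟨N, hN, hle.trans ?_⟩
  gcongr with i

/-- If `Γ_x ⊊ L_x`, then `{ω ∈ (0,1] : Γ_x = Γ_{x↾ω}}` is meager in `(0,1]`. -/
theorem stmt2 (x : ℕ → ℝ) (h : statClusterPts x ⊂ limitPts x) :
    IsMeagre {ω : Set.Ioc (0 : ℝ) 1 | statClusterPts x = statClusterPts (subseq x ω.1)} := by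
  obtain ⟨-, hne⟩ := h
  obtain ⟨ℓ, hℓ, hℓΓ⟩ := Set.not_subset.1 hne
  filter_upwards [IsLimitPt.eventually_residual_mem_statClusterPts hℓ] with ω hω heq
  exact hℓΓ (heq.symm.subset hω)
end

section
/- Let x = (x_n) be a real sequence such that every ordinary limit point of x is also a statistical limit point of x, i.e., Λ_x = L_x. Then the set {ω ∈ (0,1] : Λ_x = Λ_{x↾ω}} is comeager in (0,1]. -/
open Filter Set Topology
open scoped Classical

/-- Every finite string of binary digits can be appended inside a given open dyadic interval. -/
lemma exists_dyadic_subinterval (Q : ℕ → Prop) (N : ℕ) (k : ℤ) (j : ℕ) :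
    ∃ k' : ℤ, ∀ ω : ℝ, (k' : ℝ) < 2 ^ (N + j) * ω → 2 ^ (N + j) * ω < k' + 1 →
      ((k : ℝ) < 2 ^ N * ω ∧ 2 ^ N * ω < k + 1) ∧
      ∀ n, N < n → n ≤ N + j → (binDigit ω n = 1 ↔ Q n) := by
  induction j with
  | zero => exact ⟨k, fun ω h₁ h₂ => ⟨⟨h₁, h₂⟩, fun n h₃ h₄ => by omega⟩⟩
  | succ j ih =>
    obtain ⟨k', hk'⟩ := ih
    obtain ⟨d, hd, hdQ⟩ : ∃ d : ℤ, (d = 0 ∨ d = 1) ∧ (d = 1 ↔ Q (N + j + 1)) := by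
      by_cases hQ : Q (N + j + 1)
      · exact ⟨1, by simp, by simp [hQ]⟩
      · exact ⟨0, by simp, by simp [hQ]⟩
    refine ⟨2 * k' + d, fun ω h₁ h₂ => ?_⟩
    have hpow : (2 : ℝ) ^ (N + (j + 1)) * ω = 2 * (2 ^ (N + j) * ω) := by
      rw [← add_assoc, pow_succ]; ring
    have hd₀ : (0 : ℝ) ≤ d := by rcases hd with rfl | rfl <;> norm_num
    have hd₁ : (d : ℝ) ≤ 1 := by rcases hd with rfl | rfl <;> norm_num
    have h₁' := h₁
    have h₂' := h₂
    rw [hpow] at h₁' h₂'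
    push_cast at h₁' h₂'
    have hlow : (k' : ℝ) < 2 ^ (N + j) * ω := by linarith
    have hupp : 2 ^ (N + j) * ω < (k' : ℝ) + 1 := by linarith
    obtain ⟨hI, hdig⟩ := hk' ω hlow hupp
    refine ⟨hI, fun n hn₁ hn₂ => ?_⟩
    rcases Nat.lt_or_ge (N + j) n with hn | hn
    · obtain rfl : n = N + j + 1 := by omega
      have hc : ⌈(2 : ℝ) ^ (N + j) * ω⌉ = k' + 1 := by
        rw [Int.ceil_eq_iff]; push_cast; constructor <;> linarith
      have hc' : ⌈(2 : ℝ) ^ (N + j + 1) * ω⌉ = 2 * k' + d + 1 := by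
        rw [Int.ceil_eq_iff, add_assoc N j 1, hpow]; push_cast; constructor <;> linarith
      rw [← hdQ, binDigit, Nat.add_sub_cancel, hc, hc']
      constructor <;> intro h <;> omega
    · exact hdig n hn₁ hn

/-- Every nonempty open subset of `(0,1]` contains an open dyadic interval. -/
lemma exists_dyadic_interval_subset {U : Set (Set.Ioc (0 : ℝ) 1)} (hU : IsOpen U)
    (hne : U.Nonempty) :
    ∃ (N : ℕ) (k : ℤ), ∀ ω : ℝ, (k : ℝ) < 2 ^ N * ω → 2 ^ N * ω < k + 1 →
      ∃ h : ω ∈ Set.Ioc (0 : ℝ) 1, (⟨ω, h⟩ : Set.Ioc (0 : ℝ) 1) ∈ U := by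
  obtain ⟨⟨ω₀, hω₀⟩, hmem⟩ := hne
  obtain ⟨ε, hε, hball⟩ := Metric.isOpen_iff.1 hU _ hmem
  obtain ⟨N, hN⟩ := exists_pow_lt_of_lt_one hε (by norm_num : (1 / 2 : ℝ) < 1)
  have hpos : (0 : ℝ) < 2 ^ N := by positivity
  have hinv : (1 / 2 : ℝ) ^ N * 2 ^ N = 1 := by rw [← mul_pow]; norm_num
  have hεN : 1 < ε * 2 ^ N := by nlinarith
  have hc₀ : 0 < ⌈(2 : ℝ) ^ N * ω₀⌉ := Int.ceil_pos.2 (mul_pos hpos hω₀.1)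
  have hc₁ : ⌈(2 : ℝ) ^ N * ω₀⌉ ≤ 2 ^ N := by
    rw [Int.ceil_le]; push_cast; nlinarith [hω₀.2]
  have hl := Int.le_ceil ((2 : ℝ) ^ N * ω₀)
  have hu := Int.ceil_lt_add_one ((2 : ℝ) ^ N * ω₀)
  have hc₀' : (1 : ℝ) ≤ ⌈(2 : ℝ) ^ N * ω₀⌉ := by exact_mod_cast hc₀
  have hc₁' : (⌈(2 : ℝ) ^ N * ω₀⌉ : ℝ) ≤ 2 ^ N := by exact_mod_cast hc₁
  refine ⟨N, ⌈(2 : ℝ) ^ N * ω₀⌉ - 1, fun ω h₁ h₂ => ?_⟩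
  push_cast at h₁ h₂
  refine ⟨⟨?_, ?_⟩, hball ?_⟩
  · by_contra! hneg
    nlinarith
  · by_contra! hneg
    nlinarith
  · rw [Metric.mem_ball, Subtype.dist_eq, Real.dist_eq, abs_lt]
    constructor <;> by_contra! hneg <;> nlinarith

/-- If `Q` holds infinitely often, then for a generic `ω` the indices selected by `ω` contain
arbitrarily late blocks `[a, 2a]` of positions at which `Q` holds. -/
lemma residual_exists_block {Q : ℕ → Prop} (hQ : {n | Q n}.Infinite) (m : ℕ) :
    ∀ᶠ ω : Set.Ioc (0 : ℝ) 1 in residual (Set.Ioc (0 : ℝ) 1), ∃ a, m < a ∧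
      ∀ i, a ≤ i → i ≤ 2 * a →
        i ≤ Nat.nth (fun n => n ∈ digitOneSet ω.1) i ∧
        Nat.nth (fun n => n ∈ digitOneSet ω.1) i ∈ digitOneSet ω.1 ∧
        Q (Nat.nth (fun n => n ∈ digitOneSet ω.1) i) := by
  set S := {ω : Set.Ioc (0 : ℝ) 1 | ∃ a, m < a ∧
      ∀ i, a ≤ i → i ≤ 2 * a →
        i ≤ Nat.nth (fun n => n ∈ digitOneSet ω.1) i ∧
        Nat.nth (fun n => n ∈ digitOneSet ω.1) i ∈ digitOneSet ω.1 ∧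
        Q (Nat.nth (fun n => n ∈ digitOneSet ω.1) i)}
  change S ∈ _
  refine mem_of_superset (residual_of_dense_open isOpen_interior ?_) interior_subset
  rw [dense_iff_inter_open]
  intro U hU hne
  obtain ⟨N, k, hNk⟩ := exists_dyadic_interval_subset hU hne
  set a := N + m + 1 with ha
  obtain ⟨t, htQ, htcard⟩ := (hQ.sdiff (Set.finite_Iic N)).exists_subset_card_eq (2 * a + 1)
  obtain ⟨j, hj⟩ : ∃ j, ∀ n ∈ t, n ≤ N + j :=
    ⟨t.sup id, fun n hn => (Finset.le_sup (f := id) hn).trans (Nat.le_add_left _ _)⟩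
  obtain ⟨k', hk'⟩ := exists_dyadic_subinterval Q N k j
  have hpos : (0 : ℝ) < 2 ^ (N + j) := by positivity
  have hmid : (2 : ℝ) ^ (N + j) * ((k' + 1 / 2) / 2 ^ (N + j)) = k' + 1 / 2 := by
    field_simp
  have hmid₁ : (k' : ℝ) < 2 ^ (N + j) * ((k' + 1 / 2) / 2 ^ (N + j)) := by rw [hmid]; linarith
  have hmid₂ : (2 : ℝ) ^ (N + j) * ((k' + 1 / 2) / 2 ^ (N + j)) < k' + 1 := by
    rw [hmid]; linarith
  obtain ⟨hI, -⟩ := hk' _ hmid₁ hmid₂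
  obtain ⟨hmem, hmemU⟩ := hNk _ hI.1 hI.2
  refine ⟨⟨_, hmem⟩, hmemU, ?_⟩
  rw [mem_interior]
  refine ⟨{ω | (k' : ℝ) < 2 ^ (N + j) * ω.1 ∧ 2 ^ (N + j) * ω.1 < (k' : ℝ) + 1}, ?_, ?_,
    hmid₁, hmid₂⟩
  · rintro ⟨ω, hω⟩ ⟨h₁, h₂⟩
    obtain ⟨-, hdig⟩ := hk' ω h₁ h₂
    refine ⟨a, by omega, fun i hi₁ hi₂ => ?_⟩
    have hcount : i < Nat.count (fun n => n ∈ digitOneSet ω) (N + j + 1) := by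
      rw [Nat.count_eq_card_filter_range]
      refine lt_of_lt_of_le (by omega) (htcard.symm.le.trans (Finset.card_le_card ?_))
      intro n hn
      obtain ⟨hnQ, hnN⟩ := htQ hn
      have hnN' : N < n := by simpa using hnN
      have := hj n hn
      rw [Finset.mem_filter, Finset.mem_range]
      exact ⟨by omega, by omega, (hdig n hnN' this).2 hnQ⟩
    have hlt := Nat.nth_lt_of_lt_count hcount
    have hcard : ∀ hf : (Set.ofPred fun n => n ∈ digitOneSet ω).Finite, i < hf.toFinset.card :=
      fun hf => hcount.trans_le (Nat.count_le_card hf _)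
    have hP := Nat.nth_mem i hcard
    have hle : i ≤ Nat.nth (fun n => n ∈ digitOneSet ω) i := by
      conv_lhs => rw [← Nat.count_nth hcard]
      exact Nat.count_le _
    exact ⟨hle, hP,
      (hdig (Nat.nth (fun n => n ∈ digitOneSet ω) i) (by omega) (by omega)).1 hP.2⟩
  · have hc : Continuous fun ω : Set.Ioc (0 : ℝ) 1 => (2 : ℝ) ^ (N + j) * ω.1 := by fun_prop
    exact (isOpen_lt continuous_const hc).inter (isOpen_lt hc continuous_const)

/-- A set containing arbitrarily late blocks `[a, 2a]` has positive upper density. -/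
lemma upperDensity_pos_of_blocks {A : Set ℕ} (hA : ∀ m, ∃ a, m < a ∧ Set.Icc a (2 * a) ⊆ A) :
    0 < upperDensity A := by
  refine lt_of_lt_of_le (by norm_num : (0 : ℝ) < 1 / 2) ?_
  refine le_limsup_of_frequently_le ?_ ?_
  · rw [frequently_atTop]
    intro m
    obtain ⟨a, hma, haA⟩ := hA m
    refine ⟨2 * a, by omega, ?_⟩
    have hsub : Finset.Icc (a + 1) (2 * a) ⊆ (Finset.Icc 1 (2 * a)).filter (fun i => i ∈ A) := by
      intro i hi
      rw [Finset.mem_Icc] at hi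
      rw [Finset.mem_filter, Finset.mem_Icc]
      exact ⟨by omega, haA ⟨by omega, by omega⟩⟩
    have hcard := Finset.card_le_card hsub
    rw [Nat.card_Icc] at hcard
    have ha : a ≤ ((Finset.Icc 1 (2 * a)).filter (fun i => i ∈ A)).card := by omega
    have ha' : (a : ℝ) ≤ ((Finset.Icc 1 (2 * a)).filter (fun i => i ∈ A)).card := by
      exact_mod_cast ha
    have hpos : (0 : ℝ) < a := by exact_mod_cast (by omega : 0 < a)
    rw [le_div_iff₀ (by push_cast; linarith)]
    push_cast
    linarith
  · refine isBoundedUnder_of ⟨1, fun n => ?_⟩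
    refine div_le_one_of_le₀ ?_ (Nat.cast_nonneg n)
    have := Finset.card_filter_le (Finset.Icc 1 n) (fun i => i ∈ A)
    rw [Nat.card_Icc] at this
    exact_mod_cast this

/-- A sequence with arbitrarily late blocks `[a, 2a]` inside every neighbourhood of `ℓ` has `ℓ` as
a statistical limit point. -/
lemma isStatLimitPt_of_blocks {y : ℕ → ℝ} {ℓ : ℝ}
    (hy : ∀ j m : ℕ, ∃ a, m < a ∧ ∀ i ∈ Set.Icc a (2 * a), |y i - ℓ| < 1 / ((j : ℝ) + 1)) :
    IsStatLimitPt y ℓ := by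
  choose a hlt hblock using fun j => hy j j
  set A : Set ℕ := {i | ∃ j, i ∈ Set.Icc (a j) (2 * a j)}
  have hblocks : ∀ m, ∃ b, m < b ∧ Set.Icc b (2 * b) ⊆ A :=
    fun m => ⟨a m, hlt m, fun i hi => ⟨m, hi⟩⟩
  have hinf : (Set.ofPred fun i => i ∈ A).Infinite := by
    refine Set.infinite_of_not_bddAbove fun ⟨b, hb⟩ => ?_
    obtain ⟨c, hc, hcA⟩ := hblocks b
    have := hb (hcA ⟨le_rfl, by omega⟩)
    omega
  refine ⟨Nat.nth (fun i => i ∈ A), Nat.nth_strictMono hinf, ?_, ?_⟩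
  · rw [Metric.tendsto_atTop']
    intro ε hε
    obtain ⟨J, hJ⟩ := exists_nat_one_div_lt hε
    have hev : ∀ᶠ n in atTop, ∀ j ∈ Finset.range J, 2 * a j < n :=
      (Finset.eventually_all _).2 fun j _ => eventually_gt_atTop _
    obtain ⟨K, hK⟩ := eventually_atTop.1
      ((Nat.nth_strictMono hinf).tendsto_atTop.eventually hev)
    refine ⟨K, fun n hn => ?_⟩
    obtain ⟨j, hj⟩ := Nat.nth_mem_of_infinite hinf n
    have hJj : J ≤ j := by
      by_contra! hjJ
      exact absurd hj.2 (not_le.2 (hK n hn.le j (Finset.mem_range.2 hjJ)))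
    rw [Real.dist_eq]
    refine (hblock j _ hj).trans_le (le_trans ?_ hJ.le)
    exact Nat.one_div_le_one_div hJj
  · rw [Nat.range_nth_of_infinite hinf]
    exact upperDensity_pos_of_blocks hblocks

lemma IsStatLimitPt.isLimitPt {y : ℕ → ℝ} {ℓ : ℝ} (h : IsStatLimitPt y ℓ) : IsLimitPt y ℓ :=
  let ⟨φ, hφ, hlim, _⟩ := h
  ⟨φ, hφ, hlim⟩

lemma isLimitPt_of_subseq {x : ℕ → ℝ} {ω ℓ : ℝ} (hω : (digitOneSet ω).Infinite)
    (h : IsLimitPt (subseq x ω) ℓ) : IsLimitPt x ℓ :=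
  let ⟨φ, hφ, hlim⟩ := h
  ⟨fun k => Nat.nth (fun n => n ∈ digitOneSet ω) (φ k), (Nat.nth_strictMono hω).comp hφ, hlim⟩

lemma IsLimitPt.infinite_setOf_abs_sub_lt {x : ℕ → ℝ} {ℓ p r : ℝ} (h : IsLimitPt x ℓ)
    (hp : |ℓ - p| < r) : {n | |x n - p| < r}.Infinite := by
  obtain ⟨φ, hφ, hlim⟩ := h
  have hev : ∀ᶠ k in atTop, |x (φ k) - p| < r :=
    (hlim.sub_const p).abs.eventually_lt_const hp
  exact Nat.frequently_atTop_iff_infinite.1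
    (hφ.tendsto_atTop.frequently hev.frequently)

/-- If `Λ_x = L_x`, then `{ω ∈ (0,1] : Λ_x = Λ_{x↾ω}}` is comeager in `(0,1]`. -/
theorem stmt4 (x : ℕ → ℝ) (h : statLimitPts x = limitPts x) :
    {ω : Set.Ioc (0 : ℝ) 1 | statLimitPts x = statLimitPts (subseq x ω.1)} ∈
      residual (Set.Ioc (0 : ℝ) 1) := by
  have hinf : ∀ᶠ ω : Set.Ioc (0 : ℝ) 1 in residual (Set.Ioc (0 : ℝ) 1),
      (digitOneSet ω.1).Infinite := by
    have hall := eventually_countable_forall.2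
      (residual_exists_block (Q := fun _ => True) (by simpa using Set.infinite_univ))
    filter_upwards [hall] with ω hω
    refine Set.infinite_of_not_bddAbove fun ⟨b, hb⟩ => ?_
    obtain ⟨a, hba, ha⟩ := hω b
    obtain ⟨hle, hmem, -⟩ := ha a le_rfl (by omega)
    have := hb hmem
    omega
  have hblock : ∀ᶠ ω : Set.Ioc (0 : ℝ) 1 in residual (Set.Ioc (0 : ℝ) 1),
      ∀ (p : ℚ) (j m : ℕ), {n | |x n - p| < 1 / ((j : ℝ) + 1) / 2}.Infinite →
        ∃ a, m < a ∧ ∀ i ∈ Set.Icc a (2 * a),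
          |subseq x ω.1 i - p| < 1 / ((j : ℝ) + 1) / 2 := by
    simp only [eventually_countable_forall]
    intro p j m hQ
    filter_upwards [residual_exists_block hQ m] with ω ⟨a, hma, ha⟩
    exact ⟨a, hma, fun i hi => (ha i hi.1 hi.2).2.2⟩
  filter_upwards [hinf, hblock] with ω hω hωblock
  refine Set.Subset.antisymm (fun ℓ hℓ => ?_) fun ℓ hℓ => ?_
  · rw [h] at hℓ
    refine isStatLimitPt_of_blocks fun j m => ?_
    obtain ⟨p, hp⟩ : ∃ p : ℚ, |ℓ - p| < 1 / ((j : ℝ) + 1) / 2 :=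
      exists_rat_near ℓ (by positivity)
    obtain ⟨a, hma, ha⟩ := hωblock p j m (IsLimitPt.infinite_setOf_abs_sub_lt hℓ hp)
    refine ⟨a, hma, fun i hi => ?_⟩
    have htri := abs_sub_le (subseq x ω.1 i) p ℓ
    rw [abs_sub_comm (p : ℝ) ℓ] at htri
    linarith [ha i hi]
  · rw [h]
    exact isLimitPt_of_subseq hω (IsStatLimitPt.isLimitPt hℓ)
end

section
/- Let x = (x_n) be a real sequence and let ℓ be an ordinary limit point of x. Then the set S(ℓ) := {ω ∈ (0,1] : ℓ ∈ Γ_{x↾ω}} is comeager in (0,1]. -/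
open Filter Set Topology
open scoped Classical

/-- The first digits of `ω` past position `p` can be prescribed on a dyadic subinterval. -/
theorem exists_dyadic_binDigit_iff (T : Set ℕ) (a : ℤ) (p r : ℕ) :
    ∃ b : ℤ, ∀ ω : ℝ, (b : ℝ) < 2 ^ (p + r) * ω → 2 ^ (p + r) * ω < b + 1 →
      ((a : ℝ) < 2 ^ p * ω ∧ 2 ^ p * ω < a + 1) ∧
        ∀ n, p < n → n ≤ p + r → (binDigit ω n = 1 ↔ n ∈ T) := by
  induction r with
  | zero => exact ⟨a, fun ω h1 h2 => ⟨⟨h1, h2⟩, fun n hn hn' => by omega⟩⟩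
  | succ r ih =>
    obtain ⟨b, hb⟩ := ih
    obtain ⟨d, hd0, hd1, hd⟩ : ∃ d : ℤ, 0 ≤ d ∧ d ≤ 1 ∧ (d = 1 ↔ p + r + 1 ∈ T) := by
      by_cases hT : p + r + 1 ∈ T
      · exact ⟨1, by simp [hT]⟩
      · exact ⟨0, by simp [hT]⟩
    refine ⟨2 * b + d, fun ω h1 h2 => ?_⟩
    have hpow : (2 : ℝ) ^ (p + (r + 1)) * ω = 2 * (2 ^ (p + r) * ω) := by
      rw [← add_assoc, pow_succ]; ring
    have hd0' : (0 : ℝ) ≤ d := by exact_mod_cast hd0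
    have hd1' : (d : ℝ) ≤ 1 := by exact_mod_cast hd1
    rw [hpow] at h1 h2
    push_cast at h1 h2
    have h3 : (b : ℝ) < 2 ^ (p + r) * ω := by linarith
    have h4 : 2 ^ (p + r) * ω < (b : ℝ) + 1 := by linarith
    obtain ⟨hp, hdig⟩ := hb ω h3 h4
    refine ⟨hp, fun n hn hn' => ?_⟩
    rcases Nat.lt_or_ge (p + r) n with hlt | hle
    · obtain rfl : n = p + (r + 1) := by omega
      have hc1 : ⌈(2 : ℝ) ^ (p + (r + 1)) * ω⌉ = 2 * b + d + 1 := by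
        rw [Int.ceil_eq_iff, hpow]
        push_cast
        constructor <;> linarith
      have hc2 : ⌈(2 : ℝ) ^ (p + r) * ω⌉ = b + 1 := by
        rw [Int.ceil_eq_iff]
        push_cast
        constructor <;> linarith
      have hs : p + (r + 1) - 1 = p + r := by omega
      rw [binDigit, hs, hc1, hc2, ← add_assoc p r 1, ← hd]
      constructor <;> intro h <;> linarith
    · exact hdig n hn hle

/-- If `0 ∉ S` and, within `(p, q]`, the sets `S` and `T` agree and have many elements, then some
long initial segment of the enumeration of `S` lies in `T` for at least half of its indices. -/
theorem card_nth_filter_ge {S T : Set ℕ} {p q K : ℕ} (h0 : 0 ∉ S)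
    (hST : ∀ n, p < n → n ≤ q → (n ∈ S ↔ n ∈ T))
    (hK : 2 * p + K + 2 ≤ ((Finset.Ioc p q).filter (· ∈ T)).card) :
    ∃ N, K < N ∧
      N ≤ 2 * ((Finset.Icc 1 N).filter (fun i => Nat.nth (· ∈ S) i ∈ T)).card := by
  have hM : 2 * p + K + 2 ≤ Nat.count (· ∈ S) (q + 1) := by
    refine hK.trans ?_
    rw [Nat.count_eq_card_filter_range]
    refine Finset.card_le_card fun n hn => ?_
    simp only [Finset.mem_filter, Finset.mem_Ioc, Finset.mem_range] at hn ⊢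
    exact ⟨by omega, (hST n hn.1.1 hn.1.2).2 hn.2⟩
  have hp : Nat.count (· ∈ S) (p + 1) ≤ p := by
    rw [Nat.count_eq_card_filter_range]
    calc _ ≤ (Finset.Icc 1 p).card := by
          refine Finset.card_le_card fun n hn => ?_
          simp only [Finset.mem_filter, Finset.mem_range, Finset.mem_Icc] at hn ⊢
          have : n ≠ 0 := fun h => h0 (h ▸ hn.2)
          omega
      _ = p := by simp
  set M := Nat.count (· ∈ S) (q + 1) with hMdef
  have hgood : ∀ i, p ≤ i → i < M → Nat.nth (· ∈ S) i ∈ T := by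
    intro i hpi hi
    have hfin : ∀ hf : (Set.ofPred (· ∈ S)).Finite, i < hf.toFinset.card := fun hf => by
      refine hi.trans_le ?_
      rw [hMdef, Nat.count_eq_card_filter_range]
      refine Finset.card_le_card fun n hn => ?_
      exact hf.mem_toFinset.2 (Finset.mem_filter.1 hn).2
    have hlt : Nat.nth (· ∈ S) i < q + 1 := Nat.nth_lt_of_lt_count hi
    have hmem : Nat.nth (· ∈ S) i ∈ S := Nat.nth_mem i hfin
    have hgt : p < Nat.nth (· ∈ S) i := by
      by_contra! hle
      have h1 := Nat.count_monotone (· ∈ S) (Nat.succ_le_succ hle)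
      rw [Nat.succ_eq_add_one, Nat.count_nth_succ hfin] at h1
      simp only [Nat.succ_eq_add_one] at h1
      omega
    exact (hST _ hgt (by omega)).1 hmem
  refine ⟨M - 1, by omega, ?_⟩
  have hcard : (Finset.Icc (p + 1) (M - 1)).card ≤
      ((Finset.Icc 1 (M - 1)).filter (fun i => Nat.nth (· ∈ S) i ∈ T)).card := by
    refine Finset.card_le_card fun i hi => ?_
    simp only [Finset.mem_filter, Finset.mem_Icc] at hi ⊢
    exact ⟨by omega, hgood i (by omega) (by omega)⟩
  rw [Nat.card_Icc] at hcard
  omega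

theorem half_le_upperDensity {X : Set ℕ}
    (hX : ∀ K, ∃ N, K < N ∧ N ≤ 2 * ((Finset.Icc 1 N).filter (· ∈ X)).card) :
    1 / 2 ≤ upperDensity X := by
  refine le_limsup_of_frequently_le ?_ ?_
  · refine frequently_atTop.2 fun K => ?_
    obtain ⟨N, hKN, hN⟩ := hX K
    refine ⟨N, hKN.le, ?_⟩
    have hpos : (0 : ℝ) < N := by exact_mod_cast (Nat.zero_le K).trans_lt hKN
    have hN' : (N : ℝ) ≤ 2 * ((Finset.Icc 1 N).filter (· ∈ X)).card := by exact_mod_cast hN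
    rw [le_div_iff₀ hpos]
    linarith
  · refine isBoundedUnder_of ⟨1, fun n => div_le_one_of_le₀ ?_ n.cast_nonneg⟩
    have h := Finset.card_filter_le (Finset.Icc 1 n) (· ∈ X)
    rw [Nat.card_Icc, Nat.add_sub_cancel] at h
    exact_mod_cast h

theorem Set.Infinite.exists_le_card_Ioc {T : Set ℕ} (hT : T.Infinite) (p K : ℕ) :
    ∃ r, K ≤ ((Finset.Ioc p (p + r)).filter (· ∈ T)).card := by
  have hinf : (T \ Set.Iic p).Infinite := hT.sdiff (Set.finite_Iic p)
  obtain ⟨F, hF, hcard⟩ := hinf.exists_subset_card_eq K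
  refine ⟨F.sup id, ?_⟩
  rw [← hcard]
  refine Finset.card_le_card fun n hn => ?_
  have h1 := hF hn
  have h2 : n ≤ F.sup id := Finset.le_sup (f := id) hn
  simp only [Set.mem_sdiff, Set.mem_Iic, not_le] at h1
  simp only [Finset.mem_filter, Finset.mem_Ioc]
  exact ⟨⟨h1.2, by omega⟩, h1.1⟩

/-- For infinite `T`, generically the enumeration of the chosen indices has arbitrarily long
initial segments at least half of which lie in `T`. -/
theorem residual_exists_half_le {T : Set ℕ} (hT : T.Infinite) (K : ℕ) :
    {ω : Set.Ioc (0 : ℝ) 1 | ∃ N, K < N ∧ N ≤ 2 * ((Finset.Icc 1 N).filter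
      (fun i => Nat.nth (fun n => n ∈ digitOneSet ω.1) i ∈ T)).card} ∈
      residual (Set.Ioc (0 : ℝ) 1) := by
  refine mem_of_superset (residual_of_dense_open isOpen_interior ?_) interior_subset
  refine dense_iff_inter_open.2 ?_
  rintro V hV ⟨ω₀, hω₀⟩
  obtain ⟨ε, hε, hball⟩ := Metric.isOpen_iff.1 hV ω₀ hω₀
  obtain ⟨p, hp⟩ := exists_pow_lt_of_lt_one hε (by norm_num : (1 / 2 : ℝ) < 1)
  obtain ⟨r, hr⟩ := hT.exists_le_card_Ioc p (2 * p + K + 2)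
  set a : ℤ := ⌈(2 : ℝ) ^ p * ω₀.1⌉ - 1 with ha
  have hpp : (0 : ℝ) < 2 ^ p := by positivity
  have ha0 : (0 : ℝ) ≤ a := by
    have : 0 < ⌈(2 : ℝ) ^ p * ω₀.1⌉ := Int.ceil_pos.2 (mul_pos hpp ω₀.2.1)
    exact_mod_cast (by omega : 0 ≤ a)
  have ha1 : (a : ℝ) + 1 ≤ 2 ^ p := by
    have : ⌈(2 : ℝ) ^ p * ω₀.1⌉ ≤ 2 ^ p := by
      refine Int.ceil_le.2 ?_
      push_cast
      exact mul_le_of_le_one_right hpp.le ω₀.2.2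
    have h' : a + 1 ≤ 2 ^ p := by omega
    exact_mod_cast h'
  have ha2 : (a : ℝ) < 2 ^ p * ω₀.1 := by
    have := Int.ceil_lt_add_one ((2 : ℝ) ^ p * ω₀.1)
    rw [ha]; push_cast; linarith
  have ha3 : 2 ^ p * ω₀.1 ≤ (a : ℝ) + 1 := by
    have := Int.le_ceil ((2 : ℝ) ^ p * ω₀.1)
    rw [ha]; push_cast; linarith
  obtain ⟨b, hb⟩ := exists_dyadic_binDigit_iff T a p r
  have hqp : (0 : ℝ) < 2 ^ (p + r) := by positivity
  set W : Set (Set.Ioc (0 : ℝ) 1) :=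
    {ω | (b : ℝ) < 2 ^ (p + r) * ω.1 ∧ 2 ^ (p + r) * ω.1 < b + 1} with hW
  have hcont : Continuous fun ω : Set.Ioc (0 : ℝ) 1 => (2 : ℝ) ^ (p + r) * ω.1 := by fun_prop
  have hWo : IsOpen W :=
    (isOpen_lt continuous_const hcont).inter (isOpen_lt hcont continuous_const)
  have hWsub : W ⊆ {ω : Set.Ioc (0 : ℝ) 1 | ∃ N, K < N ∧ N ≤ 2 * ((Finset.Icc 1 N).filter
      (fun i => Nat.nth (fun n => n ∈ digitOneSet ω.1) i ∈ T)).card} := by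
    rintro ω ⟨h1, h2⟩
    refine card_nth_filter_ge (fun h => absurd h.1 (by omega)) (fun n hn hn' => ?_) hr
    rw [← (hb ω h1 h2).2 n hn hn']
    exact and_iff_right (by omega)
  set y : ℝ := (b + 1 / 2) / 2 ^ (p + r) with hy
  have hyb : 2 ^ (p + r) * y = b + 1 / 2 := by rw [hy]; field_simp
  have hy1 : (b : ℝ) < 2 ^ (p + r) * y := by rw [hyb]; linarith
  have hy2 : 2 ^ (p + r) * y < (b : ℝ) + 1 := by rw [hyb]; linarith
  obtain ⟨hya, hya'⟩ := (hb y hy1 hy2).1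
  have hy0 : 0 < y := pos_of_mul_pos_right (ha0.trans_lt hya) hpp.le
  have hyle : y ≤ 1 := by
    by_contra! hgt
    nlinarith
  refine ⟨⟨y, hy0, hyle⟩, hball ?_, interior_maximal hWsub hWo ⟨hy1, hy2⟩⟩
  rw [Metric.mem_ball, Subtype.dist_eq, Real.dist_eq]
  refine lt_of_le_of_lt ?_ hp
  have hinv : (2 : ℝ) ^ p * (1 / 2) ^ p = 1 := by rw [← mul_pow]; norm_num
  rw [abs_le]
  constructor <;> refine le_of_mul_le_mul_left ?_ hpp <;> linarith

theorem IsLimitPt.infinite_abs_sub_le {x : ℕ → ℝ} {ℓ : ℝ} (h : IsLimitPt x ℓ) {ε : ℝ}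
    (hε : 0 < ε) : {n | |x n - ℓ| ≤ ε}.Infinite := by
  obtain ⟨φ, hφ, hx⟩ := h
  obtain ⟨k, hk⟩ := Metric.tendsto_atTop.1 hx ε hε
  refine Set.infinite_of_not_bddAbove fun ⟨B, hB⟩ => ?_
  have h1 : φ (max k (B + 1)) ≤ B :=
    hB (by simpa [Real.dist_eq] using (hk _ (le_max_left k (B + 1))).le)
  have h2 := hφ.id_le (max k (B + 1))
  simp only [id] at h2
  omega

/-- Lemma: if `ℓ` is an ordinary limit point of `x`, then
`S(ℓ) = {ω ∈ (0,1] : ℓ ∈ Γ_{x↾ω}}` is comeager in `(0,1]`. -/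
theorem stmt5 (x : ℕ → ℝ) (ℓ : ℝ) (h : IsLimitPt x ℓ) :
    {ω : Set.Ioc (0 : ℝ) 1 | ℓ ∈ statClusterPts (subseq x ω.1)} ∈
      residual (Set.Ioc (0 : ℝ) 1) := by
  have hres := (countable_iInter_mem (l := residual (Set.Ioc (0 : ℝ) 1))).2 fun m : ℕ =>
    countable_iInter_mem.2 fun K : ℕ => residual_exists_half_le
      (h.infinite_abs_sub_le (Nat.one_div_pos_of_nat (α := ℝ) (n := m))) K
  filter_upwards [hres] with ω hω ε hε
  obtain ⟨m, hm⟩ := exists_nat_one_div_lt hε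
  refine one_half_pos.trans_le (half_le_upperDensity fun K => ?_)
  obtain ⟨N, hKN, hN⟩ := Set.mem_iInter.1 (Set.mem_iInter.1 hω m) K
  refine ⟨N, hKN, hN.trans (Nat.mul_le_mul_left 2 (Finset.card_le_card fun i hi => ?_))⟩
  rw [Finset.mem_filter] at hi ⊢
  exact ⟨hi.1, le_trans hi.2 hm.le⟩
end

section
/- Let x = (x_n) be a real sequence and let ℓ be an ordinary limit point of x. Then for all m, k, n ∈ ℕ with m, k ≥ 1, the set Q(m,k,n) := ⋂_{N ≥ n} {ω ∈ (0,1] : q_{ω,m}(N) < 1/(2k)} is nowhere dense in (0,1]. -/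
open Filter Set Topology
open scoped Classical

/-- The indices of terms of `x` close to an ordinary limit point form an infinite set. -/
theorem IsLimitPt.infinite_setOf_abs_sub_le {x : ℕ → ℝ} {ℓ : ℝ} (h : IsLimitPt x ℓ)
    {ε : ℝ} (hε : 0 < ε) : {i | |x i - ℓ| ≤ ε}.Infinite := by
  obtain ⟨φ, hφ, hx⟩ := h
  refine Set.infinite_of_forall_exists_gt fun a => ?_
  obtain ⟨K, hK⟩ := Metric.tendsto_atTop.1 hx ε hε
  refine ⟨φ (max K (a + 1)), ?_, ?_⟩
  · have := hK _ (le_max_left K (a + 1))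
    rw [Real.dist_eq] at this
    exact this.le
  · exact lt_of_lt_of_le (by omega) ((le_max_right K (a + 1)).trans (hφ.le_apply))

/-- A dyadic interval of level `M` contains dyadic intervals of any level `L ≥ M` on which the
digits of index in `(M, L]` are prescribed. -/
theorem exists_ceil_forall_binDigit (A : Set ℕ) (M : ℕ) (c : ℤ) {L : ℕ} (hL : M ≤ L) :
    ∃ c' : ℤ, ∀ ω : ℝ, ⌈(2 : ℝ) ^ L * ω⌉ = c' →
      ⌈(2 : ℝ) ^ M * ω⌉ = c ∧ ∀ i, M < i → i ≤ L → (binDigit ω i = 1 ↔ i ∈ A) := by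
  induction L, hL using Nat.le_induction with
  | base => exact ⟨c, fun ω h => ⟨h, fun i h₁ h₂ => by omega⟩⟩
  | succ L hL ih =>
    obtain ⟨c', hc'⟩ := ih
    refine ⟨2 * c' - 1 + if L + 1 ∈ A then 1 else 0, fun ω hω => ?_⟩
    have hceil : ⌈(2 : ℝ) ^ L * ω⌉ = c' := by
      rw [Int.ceil_eq_iff] at hω ⊢
      rw [pow_succ] at hω
      split_ifs at hω <;> push_cast at hω <;> constructor <;> linarith [hω.1, hω.2]
    refine ⟨(hc' ω hceil).1, fun i h₁ h₂ => ?_⟩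
    rcases Nat.le_succ_iff.1 h₂ with h₂ | rfl
    · exact (hc' ω hceil).2 i h₁ h₂
    · rw [binDigit, Nat.succ_eq_add_one, Nat.add_sub_cancel, hceil, hω]
      split_ifs with hA <;> simp [hA]

theorem lt_card_of_lt_count {p : ℕ → Prop} {a i : ℕ} (hi : i < Nat.count p a)
    (hf : (Set.ofPred p).Finite) : i < hf.toFinset.card := by
  refine hi.trans_le ?_
  rw [Nat.count_eq_card_filter_range]
  exact Finset.card_le_card fun j hj => hf.mem_toFinset.2 (Finset.mem_filter.1 hj).2

/-- If every index in `(M, L]` whose digit is `1` is the index of a term within `1/m` of `ℓ`,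
then at most `M` of the terms of `x↾ω` with index at most `L` are not within `1/m` of `ℓ`. -/
theorem count_le_card_filter_add (x : ℕ → ℝ) (ℓ ω : ℝ) (m M L : ℕ)
    (h : ∀ i, M < i → i ≤ L → binDigit ω i = 1 → |x i - ℓ| ≤ 1 / m) :
    Nat.count (· ∈ digitOneSet ω) (L + 1) ≤
      ((Finset.range (Nat.count (· ∈ digitOneSet ω) (L + 1))).filter
        (fun i => |subseq x ω i - ℓ| ≤ 1 / m)).card + M := by
  set N := Nat.count (· ∈ digitOneSet ω) (L + 1)
  have hsplit := Finset.card_filter_add_card_filter_not (s := Finset.range N)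
    (fun i => |subseq x ω i - ℓ| ≤ 1 / m)
  have hbad : ((Finset.range N).filter (fun i => ¬ |subseq x ω i - ℓ| ≤ 1 / m)).card ≤ M := by
    have hcard : (Finset.Icc 1 M).card = M := by simp
    refine (Finset.card_le_card_of_injOn (Nat.nth (· ∈ digitOneSet ω)) ?_ ?_).trans hcard.le
    · intro i hi
      obtain ⟨hiN, hi⟩ := Finset.mem_filter.1 hi
      rw [Finset.mem_range] at hiN
      have hmem : Nat.nth (· ∈ digitOneSet ω) i ∈ digitOneSet ω :=
        Nat.nth_mem i (lt_card_of_lt_count hiN)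
      have hlt := Nat.nth_lt_of_lt_count hiN
      refine Finset.mem_coe.2 (Finset.mem_Icc.2 ⟨hmem.1, ?_⟩)
      by_contra! hM
      exact hi (h _ hM (Nat.lt_succ_iff.1 hlt) hmem.2)
    · intro i hi j hj hij
      have hi := Finset.mem_range.1 (Finset.mem_filter.1 hi).1
      have hj := Finset.mem_range.1 (Finset.mem_filter.1 hj).1
      rw [← Nat.count_nth (p := (· ∈ digitOneSet ω)) (lt_card_of_lt_count hi), hij,
        Nat.count_nth (lt_card_of_lt_count hj)]
  rw [Finset.card_range] at hsplit
  omega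

/-- If `ℓ` is an ordinary limit point of `x`, then for all `m, k ≥ 1` and all `n`,
the set `Q(m,k,n) = ⋂_{N ≥ n} {ω ∈ (0,1] : q_{ω,m}(N) < 1/(2k)}` is nowhere dense in `(0,1]`. -/
theorem stmt6 (x : ℕ → ℝ) (ℓ : ℝ) (h : IsLimitPt x ℓ) (m k n : ℕ)
    (hm : 1 ≤ m) (hk : 1 ≤ k) :
    IsNowhereDense
      (⋂ N : ℕ, ⋂ _ : n ≤ N,
        {ω : Set.Ioc (0 : ℝ) 1 | qdens x ℓ ω.1 m N < 1 / (2 * (k : ℝ))}) := by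
  rw [IsNowhereDense, Set.eq_empty_iff_forall_notMem]
  intro ω₀ hω₀
  obtain ⟨ε, hε, hball⟩ := Metric.isOpen_iff.1 isOpen_interior ω₀ hω₀
  obtain ⟨M, hM⟩ := exists_pow_lt_of_lt_one hε (by norm_num : (1 / 2 : ℝ) < 1)
  have hm' : (0 : ℝ) < 1 / m := by positivity
  set A : Set ℕ := {i | |x i - ℓ| ≤ 1 / m}
  obtain ⟨s, hsA, hs⟩ := ((h.infinite_setOf_abs_sub_le hm').sdiff
    (Set.finite_Iic M)).exists_subset_card_eq (2 * M + n + 1)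
  set L := max M (s.sup id)
  obtain ⟨c, hc⟩ := exists_ceil_forall_binDigit A M ⌈(2 : ℝ) ^ M * ω₀.1⌉ (le_max_left M (s.sup id))
  have h2M : (0 : ℝ) < 2 ^ M := by positivity
  have h2L : (0 : ℝ) < 2 ^ L := by positivity
  have hnear : ∀ ω : ℝ, ⌈(2 : ℝ) ^ L * ω⌉ = c → 0 < ω ∧ ω ≤ 1 ∧ |ω - ω₀.1| < ε := by
    intro ω hω
    have hceil := (hc ω hω).1
    have hpos : (1 : ℤ) ≤ ⌈(2 : ℝ) ^ M * ω₀.1⌉ := Int.ceil_pos.2 (mul_pos h2M ω₀.2.1)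
    have hle : ⌈(2 : ℝ) ^ M * ω₀.1⌉ ≤ 2 ^ M :=
      Int.ceil_le.2 (by push_cast; nlinarith [ω₀.2.2])
    have hpos' : (1 : ℝ) ≤ (⌈(2 : ℝ) ^ M * ω₀.1⌉ : ℝ) := by exact_mod_cast hpos
    have hle' : (⌈(2 : ℝ) ^ M * ω₀.1⌉ : ℝ) ≤ 2 ^ M := by exact_mod_cast hle
    have h₁ := Int.ceil_eq_iff.1 hceil
    have h₂ := Int.ceil_eq_iff.1 (rfl : ⌈(2 : ℝ) ^ M * ω₀.1⌉ = _)
    refine ⟨?_, ?_, ?_⟩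
    · exact pos_of_mul_pos_right (by linarith [h₁.1] : 0 < (2 : ℝ) ^ M * ω) h2M.le
    · exact le_of_mul_le_mul_left (by linarith [h₁.2] : (2 : ℝ) ^ M * ω ≤ 2 ^ M * 1) h2M
    · refine lt_trans ?_ hM
      rw [one_div, inv_pow, ← one_div, lt_div_iff₀ h2M, ← abs_of_pos h2M, ← abs_mul, abs_lt]
      constructor <;> linarith [h₁.1, h₁.2, h₂.1, h₂.2]
  let V : Set (Set.Ioc (0 : ℝ) 1) := {ω | (c : ℝ) - 1 < 2 ^ L * ω.1 ∧ 2 ^ L * ω.1 < c}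
  have hV : IsOpen V :=
    isOpen_Ioo.preimage (f := fun ω : Set.Ioc (0 : ℝ) 1 => (2 : ℝ) ^ L * ω.1) (by fun_prop)
  have hVceil : ∀ ω ∈ V, ⌈(2 : ℝ) ^ L * ω.1⌉ = c :=
    fun ω hω => Int.ceil_eq_iff.2 ⟨hω.1, hω.2.le⟩
  set v : ℝ := ((c : ℝ) - 1 / 2) / 2 ^ L
  have hv : (2 : ℝ) ^ L * v = c - 1 / 2 := mul_div_cancel₀ _ h2L.ne'
  obtain ⟨hv₀, hv₁, hvε⟩ := hnear v (Int.ceil_eq_iff.2 (by constructor <;> linarith))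
  have hvcl : (⟨v, hv₀, hv₁⟩ : Set.Ioc (0 : ℝ) 1) ∈ closure _ := interior_subset (hball hvε)
  obtain ⟨ω, hωV, hωQ⟩ := mem_closure_iff.1 hvcl V hV
    (show _ ∧ _ by constructor <;> simp only <;> linarith)
  have hdig := (hc ω.1 (hVceil ω hωV)).2
  have hcount := count_le_card_filter_add x ℓ ω.1 m M L fun i h₁ h₂ h₃ => (hdig i h₁ h₂).1 h₃
  set N := Nat.count (· ∈ digitOneSet ω.1) (L + 1) with hN
  have hsN : 2 * M + n + 1 ≤ N := by
    rw [hN, Nat.count_eq_card_filter_range, ← hs]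
    refine Finset.card_le_card fun i hi => ?_
    have hiM : M < i := not_le.1 (hsA hi).2
    have hiL : i ≤ L := (Finset.le_sup (f := id) hi).trans (le_max_right _ _)
    exact Finset.mem_filter.2 ⟨Finset.mem_range.2 (Nat.lt_succ_of_le hiL),
      (Nat.zero_le M).trans_lt hiM, (hdig i hiM hiL).2 (hsA hi).1⟩
  have hq : qdens x ℓ ω.1 m N < 1 / (2 * (k : ℝ)) := by
    simp only [Set.mem_iInter] at hωQ
    exact hωQ N (by omega)
  have hk' : 1 / (2 * (k : ℝ)) ≤ 1 / 2 := by
    have : (1 : ℝ) ≤ k := by exact_mod_cast hk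
    exact one_div_le_one_div_of_le (by norm_num) (by linarith)
  refine absurd (hq.trans_le hk') (not_lt.2 ?_)
  have hNpos : (0 : ℝ) < N := by exact_mod_cast (by omega : 0 < N)
  rw [qdens, le_div_iff₀ hNpos]
  have hhalf : N ≤ 2 * ((Finset.range N).filter
      (fun i => |subseq x ω.1 i - ℓ| ≤ 1 / m)).card := by omega
  have : (N : ℝ) ≤ 2 * (((Finset.range N).filter
      (fun i => |subseq x ω.1 i - ℓ| ≤ 1 / m)).card : ℝ) := by exact_mod_cast hhalf
  linarith
end

section
/- Let y = (y_n) be a real sequence and k ∈ ℕ with k ≥ 1. Then the set Λ_y^k := {ℓ ∈ ℝ : d*({n ∈ ℕ : |y_n − ℓ| ≤ ε}) ≥ 1/k for all ε > 0} is closed in ℝ. -/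
open Filter Set Topology
open scoped Classical

theorem upperDensity_mono {X Y : Set ℕ} (h : X ⊆ Y) : upperDensity X ≤ upperDensity Y := by
  have card_le (n : ℕ) : ((Finset.Icc 1 n).filter (fun i => i ∈ Y)).card ≤ n := by
    simpa using Finset.card_filter_le (Finset.Icc 1 n) (fun i => i ∈ Y)
  refine Filter.limsup_le_limsup (Eventually.of_forall fun n => ?_) ?_ ?_
  · dsimp only
    gcongr
  · exact (isBoundedUnder_of ⟨0, fun n => by positivity⟩ :
      IsBoundedUnder (· ≥ ·) atTop _).isCoboundedUnder_le
  · exact isBoundedUnder_of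
      ⟨1, fun n => div_le_one_of_le₀ (mod_cast card_le n) (Nat.cast_nonneg n)⟩

/-- For every real sequence `y` and `k ≥ 1`, the set
`Λ_y^k = {ℓ : d*({n : |y_n − ℓ| ≤ ε}) ≥ 1/k for all ε > 0}` is closed in `ℝ`. -/
theorem stmt9 (y : ℕ → ℝ) (k : ℕ) (hk : 1 ≤ k) :
    IsClosed {ℓ : ℝ | ∀ ε : ℝ, 0 < ε →
      (1 : ℝ) / k ≤ upperDensity {n : ℕ | |y n - ℓ| ≤ ε}} := by
  refine isClosed_of_closure_subset fun ℓ hℓ ε hε => ?_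
  obtain ⟨ℓ', hℓ', hdist⟩ := Metric.mem_closure_iff.mp hℓ (ε / 2) (half_pos hε)
  rw [Real.dist_eq, abs_sub_comm] at hdist
  refine (hℓ' (ε / 2) (half_pos hε)).trans (upperDensity_mono fun n hn => ?_)
  have hn : |y n - ℓ'| ≤ ε / 2 := hn
  have := abs_sub_le (y n) ℓ' ℓ
  exact this.trans (by linarith)
end

section
/- Let x = (x_n) be a real sequence. Then the set {ω ∈ (0,1] : Λ_{x↾ω} = Γ_{x↾ω} = L_x} is comeager in (0,1]. -/
open Filter Set Topology
open scoped Classical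

/-- A set whose relative frequency is at least `1/4` infinitely often has positive upper density. -/
theorem upperDensity_pos_of_frequently {X : Set ℕ}
    (h : ∃ᶠ n in atTop, n ≤ 4 * ((Finset.Icc 1 n).filter (fun i => i ∈ X)).card) :
    0 < upperDensity X := by
  have hle : (1 / 4 : ℝ) ≤ upperDensity X := by
    apply le_limsup_of_frequently_le
    · refine (h.and_eventually (eventually_gt_atTop 0)).mono ?_
      rintro n ⟨hn, hpos⟩
      have hpos' : (0 : ℝ) < n := by exact_mod_cast hpos
      rw [le_div_iff₀ hpos']
      have : (n : ℝ) ≤ 4 * (((Finset.Icc 1 n).filter (fun i => i ∈ X)).card : ℝ) := by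
        exact_mod_cast hn
      linarith
    · refine isBoundedUnder_of ⟨1, fun n => ?_⟩
      apply div_le_one_of_le₀ _ (Nat.cast_nonneg n)
      have := Finset.card_filter_le (Finset.Icc 1 n) (fun i => i ∈ X)
      rw [Nat.card_Icc] at this
      exact_mod_cast this
  linarith

theorem upperDensity_eq_zero_of_finite {X : Set ℕ} (hX : X.Finite) : upperDensity X = 0 := by
  apply Tendsto.limsup_eq
  apply squeeze_zero (fun n => by positivity) (g := fun n : ℕ => (hX.toFinset.card : ℝ) / n)
  · intro n
    gcongr
    intro i hi
    simpa using (Finset.mem_filter.1 hi).2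
  · exact tendsto_const_div_atTop_nhds_zero_nat _

theorem mem_limitPts_iff_mapClusterPt {x : ℕ → ℝ} {ℓ : ℝ} :
    ℓ ∈ limitPts x ↔ MapClusterPt ℓ atTop x := by
  constructor
  · rintro ⟨φ, hφ, h⟩
    exact MapClusterPt.of_comp hφ.tendsto_atTop h.mapClusterPt
  · intro h
    obtain ⟨φ, hφ, h⟩ := h.tendsto_subseq
    exact ⟨φ, hφ, h⟩

theorem statLimitPts_subset_limitPts (y : ℕ → ℝ) : statLimitPts y ⊆ limitPts y :=
  fun _ ⟨φ, hφ, h, _⟩ => ⟨φ, hφ, h⟩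

theorem statClusterPts_subset_limitPts (y : ℕ → ℝ) : statClusterPts y ⊆ limitPts y := by
  intro ℓ hℓ
  rw [mem_limitPts_iff_mapClusterPt, Metric.nhds_basis_closedBall.mapClusterPt_iff_frequently]
  intro ε hε
  rw [Nat.frequently_atTop_iff_infinite]
  intro hfin
  have h := hℓ ε hε
  rw [upperDensity_eq_zero_of_finite (by simpa [Real.dist_eq] using hfin)] at h
  exact lt_irrefl _ h

/-- `ℓ` is approached by at least half of the terms along infinitely many initial segments. -/
def HalfDense (y : ℕ → ℝ) (ℓ : ℝ) : Prop :=
  ∀ ε : ℝ, 0 < ε → ∀ N : ℕ, ∃ n, N ≤ n ∧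
    n ≤ 2 * ((Finset.range n).filter (fun i => |y i - ℓ| ≤ ε)).card

theorem HalfDense.mem_statClusterPts {y : ℕ → ℝ} {ℓ : ℝ} (h : HalfDense y ℓ) :
    ℓ ∈ statClusterPts y := by
  intro ε hε
  apply upperDensity_pos_of_frequently
  rw [frequently_atTop]
  intro N
  obtain ⟨n, hn, hc⟩ := h ε hε (N + 4)
  refine ⟨n, by omega, ?_⟩
  have hsub : (Finset.range n).filter (fun i => |y i - ℓ| ≤ ε) ⊆
      insert 0 ((Finset.Icc 1 n).filter (fun i => i ∈ {n : ℕ | |y n - ℓ| ≤ ε})) := by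
    intro i hi
    simp only [Finset.mem_filter, Finset.mem_range, Finset.mem_insert, Finset.mem_Icc,
      Set.mem_ofPred_eq] at hi ⊢
    by_cases h0 : i = 0
    · exact Or.inl h0
    · exact Or.inr ⟨⟨by omega, by omega⟩, hi.2⟩
  have := (Finset.card_le_card hsub).trans (Finset.card_insert_le _ _)
  omega

theorem HalfDense.mem_statLimitPts {y : ℕ → ℝ} {ℓ : ℝ} (h : HalfDense y ℓ) :
    ℓ ∈ statLimitPts y := by
  choose g hgle hg using fun k : ℕ => h (1 / ((k : ℝ) + 1)) Nat.one_div_pos_of_nat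
  obtain ⟨t, ht0, hts⟩ : ∃ t : ℕ → ℕ, t 0 = 1 ∧ ∀ k, t (k + 1) = g k (4 * t k + 1) :=
    ⟨fun k => Nat.rec 1 (fun k m => g k (4 * m + 1)) k, rfl, fun _ => rfl⟩
  have hgrow : ∀ k, 4 * t k + 1 ≤ t (k + 1) := fun k => by rw [hts]; exact hgle k _
  have htm : StrictMono t := strictMono_nat_of_lt_succ fun k => by have := hgrow k; omega
  let A : Set ℕ := {i | ∀ k, t k ≤ i → |y i - ℓ| ≤ 1 / ((k : ℝ) + 1)}
  have hA : 0 < upperDensity A := by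
    apply upperDensity_pos_of_frequently
    rw [frequently_atTop]
    intro N
    refine ⟨t (N + 1), (Nat.le_succ N).trans (htm.le_apply (x := N + 1)), ?_⟩
    have hc : t (N + 1) ≤ 2 * ((Finset.range (t (N + 1))).filter
        (fun i => |y i - ℓ| ≤ 1 / ((N : ℝ) + 1))).card := by
      rw [hts]; exact hg N _
    have hsub : (Finset.range (t (N + 1))).filter (fun i => |y i - ℓ| ≤ 1 / ((N : ℝ) + 1)) ⊆
        Finset.range (t N) ∪ (Finset.Icc 1 (t (N + 1))).filter (fun i => i ∈ A) := by
      intro i hi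
      simp only [Finset.mem_filter, Finset.mem_range, Finset.mem_union, Finset.mem_Icc] at hi ⊢
      by_cases hlt : i < t N
      · exact Or.inl hlt
      · have h1 : 1 ≤ t N := ht0 ▸ htm.monotone (Nat.zero_le N)
        refine Or.inr ⟨⟨by omega, by omega⟩, fun k hk => hi.2.trans ?_⟩
        have hkN : k ≤ N := Nat.lt_succ_iff.1 (htm.lt_iff_lt.1 (hk.trans_lt hi.1))
        exact Nat.one_div_le_one_div hkN
    have h2 := (Finset.card_le_card hsub).trans (Finset.card_union_le _ _)
    rw [Finset.card_range] at h2
    have := hgrow N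
    omega
  have hinf : A.Infinite := fun hfin => by
    rw [upperDensity_eq_zero_of_finite hfin] at hA
    exact lt_irrefl _ hA
  have hmono : StrictMono (Nat.nth (· ∈ A)) := Nat.nth_strictMono hinf
  refine ⟨Nat.nth (· ∈ A), hmono, ?_, ?_⟩
  · rw [Metric.tendsto_nhds]
    intro ε hε
    obtain ⟨k, hk⟩ := exists_nat_one_div_lt hε
    filter_upwards [hmono.tendsto_atTop.eventually_ge_atTop (t k)] with j hj
    rw [Real.dist_eq]
    exact (Nat.nth_mem_of_infinite hinf j k hj).trans_lt hk
  · have hrange : range (Nat.nth (· ∈ A)) = A := Nat.range_nth_of_infinite (p := (· ∈ A)) hinf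
    rwa [hrange]

/-- `binTrunc ω n` is the integer whose binary expansion is `d_1(ω) … d_n(ω)`. -/
noncomputable def binTrunc (ω : ℝ) (n : ℕ) : ℤ := ⌈(2 : ℝ) ^ n * ω⌉ - 1

theorem binTrunc_eq_iff {ω : ℝ} {n : ℕ} {a : ℤ} :
    binTrunc ω n = a ↔ (a : ℝ) < 2 ^ n * ω ∧ 2 ^ n * ω ≤ a + 1 := by
  rw [binTrunc, sub_eq_iff_eq_add, Int.ceil_eq_iff]
  push_cast
  rw [add_sub_cancel_right]

theorem binTrunc_of_succ {ω : ℝ} {n : ℕ} {a e : ℤ} (he : e = 0 ∨ e = 1)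
    (h : binTrunc ω (n + 1) = 2 * a + e) : binTrunc ω n = a ∧ binDigit ω (n + 1) = e := by
  have h1 : binTrunc ω n = a := by
    rw [binTrunc_eq_iff] at h ⊢
    push_cast at h
    rw [pow_succ] at h
    rcases he with rfl | rfl <;> push_cast at h <;> constructor <;> linarith [h.1, h.2]
  refine ⟨h1, ?_⟩
  simp only [binTrunc] at h h1
  simp only [binDigit, Nat.add_sub_cancel]
  omega

/-- Any finite block of digits can be followed by digits prescribed by `S`. -/
theorem exists_binTrunc_extension (S : Set ℕ) (m : ℕ) (a : ℤ) (k : ℕ) :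
    ∃ b : ℤ, ∀ ω : ℝ, binTrunc ω (m + k) = b →
      binTrunc ω m = a ∧ ∀ j, m < j → j ≤ m + k → (j ∈ digitOneSet ω ↔ j ∈ S) := by
  induction k with
  | zero => exact ⟨a, fun ω h => ⟨h, fun j h1 h2 => by omega⟩⟩
  | succ k ih =>
    obtain ⟨b, hb⟩ := ih
    refine ⟨2 * b + (if m + k + 1 ∈ S then 1 else 0), fun ω h => ?_⟩
    obtain ⟨h1, h2⟩ := binTrunc_of_succ (by split_ifs <;> simp) h
    change binDigit ω (m + k + 1) = _ at h2
    refine ⟨(hb ω h1).1, fun j hj hj' => ?_⟩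
    rcases Nat.lt_or_ge j (m + k + 1) with hlt | hge
    · exact (hb ω h1).2 j hj (by omega)
    · obtain rfl : j = m + k + 1 := by omega
      simp only [digitOneSet, Set.mem_ofPred_eq, h2]
      split_ifs with hS <;> simp [hS]

/-- In some initial segment with at least `N` selected indices, at least half of those
are in `S`. -/
def HalfSelected (S : Set ℕ) (N : ℕ) (D : Set ℕ) : Prop :=
  ∃ M, N ≤ Nat.count (· ∈ D) M ∧ Nat.count (· ∈ D) M ≤ 2 * Nat.count (· ∈ D ∩ S) M

theorem exists_binTrunc_halfSelected {S : Set ℕ} (hS : S.Infinite) (N m : ℕ) (a : ℤ) :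
    ∃ (M : ℕ) (b : ℤ), ∀ ω : ℝ, binTrunc ω M = b →
      binTrunc ω m = a ∧ HalfSelected S N (digitOneSet ω) := by
  obtain ⟨k, hk⟩ : ∃ k, N + 2 * (m + 1) ≤ Nat.count (· ∈ S) (m + 1 + k) := by
    refine ⟨Nat.nth (· ∈ S) (N + 2 * (m + 1)), ?_⟩
    calc N + 2 * (m + 1) = Nat.count (· ∈ S) (Nat.nth (· ∈ S) (N + 2 * (m + 1))) :=
          (Nat.count_nth_of_infinite (p := (· ∈ S)) hS _).symm
      _ ≤ _ := Nat.count_monotone (· ∈ S) (Nat.le_add_left _ _)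
  obtain ⟨b, hb⟩ := exists_binTrunc_extension S m a k
  refine ⟨m + k, b, fun ω h => ?_⟩
  obtain ⟨h1, h2⟩ := hb ω h
  refine ⟨h1, m + 1 + k, ?_⟩
  rw [Nat.count_add (· ∈ S) (m + 1) k] at hk
  have hD : Nat.count (fun j => m + 1 + j ∈ digitOneSet ω) k =
      Nat.count (fun j => m + 1 + j ∈ S) k := by
    simp only [Nat.count_eq_card_filter_range]
    congr 1
    refine Finset.filter_congr fun j hj => h2 _ (by omega) ?_
    have := Finset.mem_range.1 hj
    omega
  have hDS : Nat.count (fun j => m + 1 + j ∈ digitOneSet ω ∩ S) k =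
      Nat.count (fun j => m + 1 + j ∈ S) k := by
    simp only [Nat.count_eq_card_filter_range]
    congr 1
    refine Finset.filter_congr fun j hj => ?_
    have := Finset.mem_range.1 hj
    rw [Set.mem_inter_iff, h2 _ (by omega) (by omega), and_self]
  have hS' := Nat.count_le (p := (· ∈ S)) (n := m + 1)
  have hD' := Nat.count_le (p := (· ∈ digitOneSet ω)) (n := m + 1)
  rw [Nat.count_add (· ∈ digitOneSet ω) (m + 1) k,
    Nat.count_add (· ∈ digitOneSet ω ∩ S) (m + 1) k, hD, hDS]
  omega

theorem eventually_residual_halfSelected {S : Set ℕ} (hS : S.Infinite) (N : ℕ) :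
    ∀ᶠ ω : Set.Ioc (0 : ℝ) 1 in residual (Set.Ioc (0 : ℝ) 1),
      HalfSelected S N (digitOneSet ω.1) := by
  set G : Set (Set.Ioc (0 : ℝ) 1) := {ω | HalfSelected S N (digitOneSet ω.1)}
  suffices hG : Dense (interior G) from
    mem_of_superset (residual_of_dense_open isOpen_interior hG) interior_subset
  rw [Metric.dense_iff]
  intro ω₀ r hr
  obtain ⟨m, hm⟩ := exists_pow_lt_of_lt_one hr (by norm_num : (1 / 2 : ℝ) < 1)
  obtain ⟨M, b, hb⟩ := exists_binTrunc_halfSelected hS N m (binTrunc ω₀.1 m)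
  have hp : (0 : ℝ) < 2 ^ m := by positivity
  have hP : (0 : ℝ) < 2 ^ M := by positivity
  have hω₀ := binTrunc_eq_iff.1 (rfl : binTrunc ω₀.1 m = _)
  have ha : 0 ≤ binTrunc ω₀.1 m ∧ binTrunc ω₀.1 m + 1 ≤ 2 ^ m := by
    have h1 : 0 < ⌈(2 : ℝ) ^ m * ω₀.1⌉ := Int.ceil_pos.2 (mul_pos hp ω₀.2.1)
    have h2 : ⌈(2 : ℝ) ^ m * ω₀.1⌉ ≤ 2 ^ m := by
      rw [Int.ceil_le]
      push_cast
      exact mul_le_of_le_one_right hp.le ω₀.2.2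
    unfold binTrunc
    omega
  have ha1 : (0 : ℝ) ≤ binTrunc ω₀.1 m := by exact_mod_cast ha.1
  have ha2 : (binTrunc ω₀.1 m : ℝ) + 1 ≤ 2 ^ m := by exact_mod_cast ha.2
  set V : Set (Set.Ioc (0 : ℝ) 1) := {ω | (b : ℝ) < 2 ^ M * ω.1 ∧ 2 ^ M * ω.1 < b + 1}
  have hV : IsOpen V := by
    apply IsOpen.and <;> apply isOpen_lt <;> fun_prop
  have hVG : V ⊆ G := fun ω hω => (hb ω.1 (binTrunc_eq_iff.2 ⟨hω.1, hω.2.le⟩)).2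
  set z : ℝ := (b + 1 / 2) / 2 ^ M
  have hz : 2 ^ M * z = b + 1 / 2 := mul_div_cancel₀ _ hP.ne'
  have hzm := binTrunc_eq_iff.1
    (hb z (binTrunc_eq_iff.2 ⟨by rw [hz]; linarith, by rw [hz]; linarith⟩)).1
  have hz0 : 0 < z := pos_of_mul_pos_right (ha1.trans_lt hzm.1) hp.le
  have hz1 : z ≤ 1 := le_of_mul_le_mul_left (by linarith [hzm.2]) hp
  refine ⟨⟨z, hz0, hz1⟩, ?_, interior_maximal hVG hV ?_⟩
  · rw [Metric.mem_ball, Subtype.dist_eq, Real.dist_eq]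
    refine lt_of_le_of_lt ?_ hm
    change |z - ω₀.1| ≤ _
    rw [one_div, inv_pow, ← one_div, le_div_iff₀' hp]
    calc 2 ^ m * |z - ω₀.1| = |2 ^ m * (z - ω₀.1)| := by rw [abs_mul, abs_of_pos hp]
      _ ≤ 1 := by rw [abs_le]; constructor <;> linarith [hzm.1, hzm.2, hω₀.1, hω₀.2]
  · simp only [V, Set.mem_ofPred_eq, hz]
    constructor <;> linarith

theorem infinite_of_forall_halfSelected {S D : Set ℕ} (h : ∀ N, HalfSelected S N D) :
    D.Infinite := by
  intro hfin
  obtain ⟨M, hM, -⟩ := h (hfin.toFinset.card + 1)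
  rw [Nat.count_eq_card_filter_range] at hM
  have : ((Finset.range M).filter (· ∈ D)).card ≤ hfin.toFinset.card :=
    Finset.card_le_card fun i hi => by simpa using (Finset.mem_filter.1 hi).2
  omega

theorem HalfSelected.exists_le_card {S D : Set ℕ} {N : ℕ} (h : HalfSelected S N D) :
    ∃ n, N ≤ n ∧ n ≤ 2 * ((Finset.range n).filter (fun i => Nat.nth (· ∈ D) i ∈ S)).card := by
  obtain ⟨M, hN, hM⟩ := h
  refine ⟨_, hN, hM.trans (Nat.mul_le_mul_left 2 ?_)⟩
  rw [Nat.count_eq_card_filter_range (· ∈ D ∩ S)]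
  apply Finset.card_le_card_of_injOn (Nat.count (· ∈ D))
  · intro d hd
    obtain ⟨hdM, hdD, hdS⟩ := Finset.mem_filter.1 hd
    refine Finset.mem_filter.2 ⟨Finset.mem_range.2 ?_, ?_⟩
    · exact Nat.count_strict_mono hdD (Finset.mem_range.1 hdM)
    · rwa [Nat.nth_count hdD]
  · intro d hd d' hd' heq
    exact Nat.count_injective (Finset.mem_filter.1 hd).2.1 (Finset.mem_filter.1 hd').2.1 heq

/-- The set `{ω ∈ (0,1] : Λ_{x↾ω} = Γ_{x↾ω} = L_x}` is comeager in `(0,1]`. -/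
theorem stmt10 (x : ℕ → ℝ) :
    {ω : Set.Ioc (0 : ℝ) 1 |
        statLimitPts (subseq x ω.1) = statClusterPts (subseq x ω.1) ∧
          statClusterPts (subseq x ω.1) = limitPts x} ∈
      residual (Set.Ioc (0 : ℝ) 1) := by
  have hall : ∀ᶠ ω : Set.Ioc (0 : ℝ) 1 in residual (Set.Ioc (0 : ℝ) 1),
      ∀ U ∈ TopologicalSpace.countableBasis ℝ, (x ⁻¹' U).Infinite →
        ∀ N, HalfSelected (x ⁻¹' U) N (digitOneSet ω.1) := by
    rw [eventually_countable_ball (TopologicalSpace.countable_countableBasis ℝ)]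
    intro U _
    by_cases hU : (x ⁻¹' U).Infinite
    · simpa only [hU, true_imp_iff] using
        eventually_countable_forall.2 (eventually_residual_halfSelected hU)
    · exact Eventually.of_forall fun _ h => absurd h hU
  have hinf := eventually_countable_forall.2
    (eventually_residual_halfSelected Set.infinite_univ)
  filter_upwards [hall, hinf] with ω hω hωinf
  have hD : (digitOneSet ω.1).Infinite := infinite_of_forall_halfSelected hωinf
  have hsub : limitPts (subseq x ω.1) ⊆ limitPts x := by
    rintro ℓ ⟨φ, hφ, h⟩
    exact ⟨_, (Nat.nth_strictMono hD).comp hφ, h⟩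
  have hdense : ∀ ℓ ∈ limitPts x, HalfDense (subseq x ω.1) ℓ := by
    intro ℓ hℓ ε hε N
    obtain ⟨U, hU, hℓU, hUε⟩ :=
      (TopologicalSpace.isBasis_countableBasis ℝ).mem_nhds_iff.1 (Metric.ball_mem_nhds ℓ hε)
    have hUinf : (x ⁻¹' U).Infinite := by
      rw [mem_limitPts_iff_mapClusterPt, mapClusterPt_iff_frequently] at hℓ
      exact Nat.frequently_atTop_iff_infinite.1
        (hℓ U ((TopologicalSpace.isOpen_of_mem_countableBasis hU).mem_nhds hℓU))
    obtain ⟨n, hn, hc⟩ := (hω U hU hUinf N).exists_le_card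
    refine ⟨n, hn, hc.trans (Nat.mul_le_mul_left 2 (Finset.card_le_card ?_))⟩
    refine Finset.monotone_filter_right _ fun i _ hi => ?_
    exact (Metric.mem_ball.1 (hUε hi)).le
  have hΓ : statClusterPts (subseq x ω.1) = limitPts x :=
    ((statClusterPts_subset_limitPts _).trans hsub).antisymm
      fun ℓ hℓ => (hdense ℓ hℓ).mem_statClusterPts
  have hΛ : statLimitPts (subseq x ω.1) = limitPts x :=
    ((statLimitPts_subset_limitPts _).trans hsub).antisymm
      fun ℓ hℓ => (hdense ℓ hℓ).mem_statLimitPts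
  exact ⟨hΛ.trans hΓ.symm, hΓ⟩
end
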